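/- arXiv:1112.3127 — 2 statements merged into one kernel-verified Lean document; each statement's English description precedes it below -/
import Mathlib

section
/- For every n ≥ 1, every finite-dimensional complex linear representation of the symmetric group S_n can be realized over ℚ: there exists a representation of S_n on a finite-dimensional ℚ-vector space whose complexification (extension of scalars along ℚ ⊆ ℂ) is isomorphic to the given representation. -/
open Equiv

theorem SG_conj_fix {α : Type*} [Finite α] (g h : Perm α) (m m' : ℤ) (hm : h = g ^ m)
    (hm' : g = h ^ m') (x : α) : ∃ t : Perm α, t x = x ∧ t * g * t⁻¹ = h := by
  classical
  obtain ⟨rep, r1, r2, r3⟩ : ∃ rep : α → α, (∀ y, g.SameCycle (rep y) y) ∧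
      (∀ y z, g.SameCycle y z → rep y = rep z) ∧ rep x = x := by
    let s := Perm.SameCycle.setoid g
    refine ⟨fun y => if g.SameCycle x y then x else (Quotient.mk s y).out, ?_, ?_, ?_⟩
    · intro y
      dsimp only
      split_ifs with hy
      · exact hy
      · exact Quotient.mk_out (s := s) y
    · intro y z hyz
      dsimp only
      have h1 : Quotient.mk s y = Quotient.mk s z := Quotient.sound hyz
      have h2 : g.SameCycle x y ↔ g.SameCycle x z := ⟨fun h => h.trans hyz, fun h => h.trans hyz.symm⟩
      simp only [h1, h2]
    · simp [Perm.SameCycle.refl]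
  choose k hk using r1
  -- same powers
  have key : ∀ (k l : ℤ) (r : α), (g ^ k) r = (g ^ l) r ↔ (h ^ k) r = (h ^ l) r := by
    have aux : ∀ (a b : Perm α) (c : ℤ), b = a ^ c → ∀ (k l : ℤ) (r : α), (a ^ k) r = (a ^ l) r →
        (b ^ k) r = (b ^ l) r := by
      intro a b c hb k l r hr
      have h0 : (a ^ (-l + k)) r = r := by
        rw [zpow_add, Perm.mul_apply, hr, ← Perm.mul_apply, ← zpow_add]; simp
      have h1 : (b ^ (-l + k)) r = r := by
        rw [hb, ← zpow_mul, mul_comm, zpow_mul]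
        exact Perm.zpow_apply_eq_self_of_apply_eq_self h0 c
      have : (b ^ l) ((b ^ (-l + k)) r) = (b ^ k) r := by
        rw [← Perm.mul_apply, ← zpow_add]; simp
      rw [← this, h1]
    exact fun k l r => ⟨aux g h m hm k l r, aux h g m' hm' k l r⟩
  let t0 : α → α := fun y => (h ^ (k y)) (rep y)
  have t0g : ∀ (l : ℤ) (y : α), t0 ((g ^ l) (rep y)) = (h ^ l) (rep y) := by
    intro l y
    have e1 : rep ((g ^ l) (rep y)) = rep y := by
      apply r2
      exact Perm.sameCycle_zpow_left.2 ⟨k y, hk y⟩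
    have e2 := hk ((g ^ l) (rep y))
    change (h ^ _) (rep ((g ^ l) (rep y))) = _
    rw [e1] at e2 ⊢
    exact (key _ _ _).1 e2
  have hs : ∀ y, h.SameCycle (rep y) (t0 y) := fun y => ⟨k y, rfl⟩
  have inj : Function.Injective t0 := by
    intro y z hyz
    have h1 : g.SameCycle (rep y) (rep z) := by
      have : h.SameCycle (rep y) (rep z) := (hs y).trans (hyz ▸ (hs z).symm)
      rw [hm] at this
      exact this.of_zpow
    have h2 : rep y = rep z := by
      apply r2
      have h3 : g.SameCycle (rep y) y := ⟨k y, hk y⟩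
      have h4 : g.SameCycle (rep z) z := ⟨k z, hk z⟩
      exact h3.symm.trans (h1.trans h4)
    rw [← hk y, ← hk z, h2]
    have : (h ^ (k y)) (rep y) = (h ^ (k z)) (rep z) := hyz
    rw [h2] at this
    exact (key _ _ _).2 this
  let t : Perm α := Equiv.ofBijective t0 (Finite.injective_iff_bijective.1 inj)
  refine ⟨t, ?_, ?_⟩
  · have := t0g 0 x
    rw [r3] at this
    exact this
  · rw [mul_inv_eq_iff_eq_mul]
    ext y
    have h1 := t0g (1 + k y) y
    rw [zpow_add, Perm.mul_apply, hk, zpow_one, zpow_add, Perm.mul_apply, zpow_one] at h1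
    exact h1

theorem SG_char_rat {α : Type*} [Finite α] {V : Type*} [AddCommGroup V] [Module ℂ V]
    [FiniteDimensional ℂ V] (ρ : Representation ℂ (Perm α) V) (g : Perm α) :
    ∃ q : ℚ, ρ.character g = (q : ℂ) := by
  classical
  have := Fintype.ofFinite α
  let K : Subfield ℂ := (algebraMap ℚ ℂ).fieldRange
  suffices hK : ∀ n : ℕ, ∀ g : Perm α, orderOf g = n → ρ.character g ∈ K by
    obtain ⟨q, hq⟩ := hK _ g rfl
    exact ⟨q, by simpa using hq.symm⟩
  intro n
  induction n using Nat.strong_induction_on with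
  | _ n ih =>
  intro g hg
  let Z := Subgroup.zpowers g
  let σ : Representation ℂ Z V := ρ.comp Z.subtype
  have hne : (Nat.card Z : ℂ) ≠ 0 := by exact_mod_cast Nat.card_pos.ne'
  let _ : Invertible (Nat.card Z : ℂ) := invertibleOfNonzero hne
  have h1 := Representation.card_inv_mul_sum_char_eq_finrank σ
  rw [inv_mul_eq_iff_eq_mul₀ hne] at h1
  have hsum : ∑ z : Z, ρ.character (z : Perm α) ∈ K := by
    change ∑ z : Z, σ.character z ∈ K
    rw [h1]
    exact mul_mem (natCast_mem K _) (natCast_mem K _)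
  rw [← Finset.sum_filter_add_sum_filter_not Finset.univ (fun z : Z => orderOf (z : Perm α) = n)]
    at hsum
  have hA : ∀ z ∈ Finset.univ.filter (fun z : Z => orderOf (z : Perm α) = n),
      ρ.character (z : Perm α) = ρ.character g := by
    rintro ⟨z, hz⟩ hzn
    simp only [Finset.mem_filter, Finset.mem_univ, true_and] at hzn
    have hle : Subgroup.zpowers z ≤ Subgroup.zpowers g := by simpa using hz
    have heq : Subgroup.zpowers z = Subgroup.zpowers g := by
      apply Subgroup.eq_of_le_of_card_ge hle
      rw [Nat.card_zpowers, Nat.card_zpowers, hzn, hg]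
    obtain ⟨m, hm⟩ := Subgroup.mem_zpowers_iff.1 hz
    have hgz : g ∈ Subgroup.zpowers z := by rw [heq]; exact Subgroup.mem_zpowers g
    obtain ⟨m', hm'⟩ := Subgroup.mem_zpowers_iff.1 hgz
    have : ∃ t : Perm α, t * g * t⁻¹ = z := by
      cases isEmpty_or_nonempty α
      · exact ⟨1, Subsingleton.elim _ _⟩
      · obtain ⟨t, _, ht⟩ := SG_conj_fix g z m m' hm.symm hm'.symm (Classical.arbitrary α)
        exact ⟨t, ht⟩
    obtain ⟨t, ht⟩ := this
    simp only
    rw [← ht, Representation.char_conj]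
  have hB : ∑ z ∈ Finset.univ.filter (fun z : Z => ¬ orderOf (z : Perm α) = n),
      ρ.character (z : Perm α) ∈ K := by
    apply sum_mem
    rintro ⟨z, hz⟩ hzn
    simp only [Finset.mem_filter, Finset.mem_univ, true_and] at hzn
    refine ih _ ?_ z rfl
    refine lt_of_le_of_ne ?_ hzn
    rw [← hg]
    apply Nat.le_of_dvd (orderOf_pos g)
    obtain ⟨m, rfl⟩ := Subgroup.mem_zpowers_iff.1 hz
    exact orderOf_dvd_of_mem_zpowers ⟨m, rfl⟩
  have hC := sub_mem hsum hB
  rw [add_sub_cancel_right, Finset.sum_congr rfl hA, Finset.sum_const, nsmul_eq_mul] at hC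
  set c := (Finset.univ.filter (fun z : Z => orderOf (z : Perm α) = n)).card with hc
  have hc0 : (c : ℂ) ≠ 0 := by
    have : 0 < c := Finset.card_pos.2 ⟨⟨g, Subgroup.mem_zpowers g⟩,
      Finset.mem_filter.2 ⟨Finset.mem_univ _, hg⟩⟩
    exact_mod_cast this.ne'
  have := mul_mem (inv_mem (natCast_mem K c)) hC
  rwa [inv_mul_cancel_left₀ hc0] at this

open Representation in
theorem SG_burnside {G : Type*} [Group G] [Finite G] {V : Type*} [AddCommGroup V] [Module ℂ V]
    [FiniteDimensional ℂ V] (ρ : Representation ℂ G V) [ρ.IsIrreducible] (T : Module.End ℂ V) :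
    T ∈ Submodule.span ℂ (Set.range ρ) := by
  classical
  let f : Module.End (Module.End (MonoidAlgebra ℂ G) ρ.asModule) ρ.asModule :=
    { toFun := T
      map_add' := fun x y => T.map_add x y
      map_smul' := by
        intro φ x
        obtain ⟨c, rfl⟩ := (IsSimpleModule.algebraMap_end_bijective_of_isAlgClosed
          (A := MonoidAlgebra ℂ G) (V := ρ.asModule) ℂ).2 φ
        exact T.map_smul c x }
  obtain ⟨s, hs⟩ := Module.Finite.fg_top (R := ℂ) (M := V)
  obtain ⟨r, hr⟩ := jacobson_density f s
  have hT : T = ρ.asAlgebraHom r := by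
    apply LinearMap.ext_on (s := (s : Set V)) (by simpa using hs)
    intro m hm
    exact hr m hm
  have hmem : ∀ r : MonoidAlgebra ℂ G, ρ.asAlgebraHom r ∈ Submodule.span ℂ (Set.range ρ) := by
    intro r
    induction r using MonoidAlgebra.induction_linear with
    | zero => simp
    | add x y hx hy => rw [map_add]; exact add_mem hx hy
    | single g a =>
      rw [asAlgebraHom_single]
      exact Submodule.smul_mem _ _ (Submodule.subset_span ⟨g, rfl⟩)
  rw [hT]
  exact hmem r

/-- Sum of conjugates -/
noncomputable def SGavg {G H : Type*} [Group G] [Group H] [Fintype H] {V : Type*} [AddCommGroup V]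
    [Module ℂ V] (ρ : Representation ℂ G V) (j : H →* G) (g : G) : Module.End ℂ V :=
  ∑ h : H, ρ (j h * g * (j h)⁻¹)

section
variable {G H : Type*} [Group G] [Group H] [Fintype H] {V : Type*} [AddCommGroup V]
    [Module ℂ V] (ρ : Representation ℂ G V) (j : H →* G)

theorem SGavg_conj (g : G) (h : H) : SGavg ρ j (j h * g * (j h)⁻¹) = SGavg ρ j g := by
  unfold SGavg
  refine Fintype.sum_bijective (· * h) (Group.mulRight_bijective h) _ _ fun i => ?_
  simp [mul_assoc]

theorem SGavg_inv (hj : ∀ g, ∃ h, j h * g * (j h)⁻¹ = g⁻¹) (g : G) :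
    SGavg ρ j g⁻¹ = SGavg ρ j g := by
  obtain ⟨h, hh⟩ := hj g
  rw [← hh, SGavg_conj]

theorem SGavg_mul (g k : G) :
    SGavg ρ j g * SGavg ρ j k = ∑ h : H, SGavg ρ j (g * (j h * k * (j h)⁻¹)) := by
  unfold SGavg
  rw [Finset.sum_mul_sum]
  conv_rhs => rw [Finset.sum_comm]
  refine Finset.sum_congr rfl fun h _ => ?_
  refine Fintype.sum_bijective (h⁻¹ * ·) (Group.mulLeft_bijective h⁻¹) _ _ fun i => ?_
  rw [← map_mul]
  congr 1
  simp [mul_assoc]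

theorem SGavg_mul' (g k : G) :
    SGavg ρ j k * SGavg ρ j g = ∑ h : H, SGavg ρ j ((j h * k * (j h)⁻¹) * g) := by
  unfold SGavg
  rw [Finset.sum_mul_sum, Finset.sum_comm]
  conv_rhs => rw [Finset.sum_comm]
  refine Finset.sum_congr rfl fun h _ => ?_
  refine Fintype.sum_bijective (h⁻¹ * ·) (Group.mulLeft_bijective h⁻¹) _ _ fun i => ?_
  rw [← map_mul]
  congr 1
  simp [mul_assoc]

theorem SGavg_comm (hj : ∀ g, ∃ h, j h * g * (j h)⁻¹ = g⁻¹) (g k : G) :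
    SGavg ρ j g * SGavg ρ j k = SGavg ρ j k * SGavg ρ j g := by
  rw [SGavg_mul, ← SGavg_inv ρ j hj k, ← SGavg_inv ρ j hj g, SGavg_mul']
  refine Finset.sum_congr rfl fun h _ => ?_
  rw [← SGavg_inv ρ j hj]
  congr 1
  simp [mul_assoc]

theorem SG_mem_span_avg [Finite G] [FiniteDimensional ℂ V] [ρ.IsIrreducible] (T : Module.End ℂ V)
    (hT : ∀ h, ρ (j h) * T = T * ρ (j h)) :
    T ∈ Submodule.span ℂ (Set.range (SGavg ρ j)) := by
  have h1 : ∀ S : Module.End ℂ V, (∑ h : H, ρ (j h) * S * ρ (j h)⁻¹) ∈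
      Submodule.span ℂ (Set.range (SGavg ρ j)) := by
    intro S
    induction SG_burnside ρ S using Submodule.span_induction with
    | mem x hx =>
      obtain ⟨g, rfl⟩ := hx
      apply Submodule.subset_span
      exact ⟨g, by simp [SGavg]⟩
    | zero => simp
    | add x y _ _ hx hy => simpa [mul_add, add_mul, Finset.sum_add_distrib] using add_mem hx hy
    | smul a x _ hx => simpa [Finset.smul_sum] using Submodule.smul_mem _ a hx
  have h2 := h1 T
  have h3 : (∑ h : H, ρ (j h) * T * ρ (j h)⁻¹) = (Fintype.card H : ℂ) • T := by
    rw [Finset.sum_congr rfl (g := fun _ => T)]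
    · simp [Nat.cast_smul_eq_nsmul]
    · intro h _
      rw [hT, mul_assoc, ← map_mul]
      simp
  rw [h3] at h2
  have := Submodule.smul_mem _ (Fintype.card H : ℂ)⁻¹ h2
  rwa [inv_smul_smul₀ (by simp)] at this

theorem SG_commute [Finite G] [FiniteDimensional ℂ V] [ρ.IsIrreducible]
    (hj : ∀ g, ∃ h, j h * g * (j h)⁻¹ = g⁻¹) (S T : Module.End ℂ V)
    (hS : ∀ h, ρ (j h) * S = S * ρ (j h))
    (hT : ∀ h, ρ (j h) * T = T * ρ (j h)) : S * T = T * S := by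
  have hS' := SG_mem_span_avg ρ j S hS
  have hT' := SG_mem_span_avg ρ j T hT
  clear hS hT
  induction hS', hT' using Submodule.span_induction₂ with
  | mem_mem x y hx hy => 
    obtain ⟨g, rfl⟩ := hx
    obtain ⟨k, rfl⟩ := hy
    exact SGavg_comm ρ j hj g k
  | zero_left => simp
  | zero_right => simp
  | add_left x y z _ _ _ h1 h2 => simp only [add_mul, mul_add, h1, h2]
  | add_right x y z _ _ _ h1 h2 => simp only [add_mul, mul_add, h1, h2]
  | smul_left r x y _ _ h => simp only [smul_mul_assoc, mul_smul_comm, h]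
  | smul_right r x y _ _ h => simp only [smul_mul_assoc, mul_smul_comm, h]

end

open Representation in
theorem SG_retract {H : Type*} [Group H] [Finite H] {V : Type*} [AddCommGroup V]
    [Module ℂ V] (ρ : Representation ℂ H V) (U : Subrepresentation ρ) :
    ∃ p : V →ₗ[ℂ] V, (∀ v, p v ∈ U.toSubmodule) ∧ (∀ u ∈ U.toSubmodule, p u = u) ∧
      ∀ h v, p (ρ h v) = ρ h (p v) := by
  have : NeZero (Nat.card H : ℂ) := ⟨by exact_mod_cast Nat.card_pos.ne'⟩
  obtain ⟨C, hC⟩ := exists_isCompl U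
  have hC' : IsCompl U.toSubmodule C.toSubmodule := by
    constructor
    · rw [disjoint_iff]
      exact congrArg Subrepresentation.toSubmodule (disjoint_iff.1 hC.1)
    · rw [codisjoint_iff]
      exact congrArg Subrepresentation.toSubmodule (codisjoint_iff.1 hC.2)
  refine ⟨Submodule.projection _ _ hC', ?_, ?_, ?_⟩
  · exact fun v => Submodule.projection_apply_mem hC' v
  · exact fun u hu => Submodule.projection_apply_left hC' ⟨u, hu⟩
  · intro h v
    have hv : v ∈ U.toSubmodule ⊔ C.toSubmodule := by rw [hC'.sup_eq_top]; trivial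
    obtain ⟨u, hu, c, hc, rfl⟩ := Submodule.mem_sup.1 hv
    have e1 := Submodule.projection_apply_left hC' ⟨u, hu⟩
    have e2 := Submodule.projection_apply_right hC' ⟨c, hc⟩
    have e3 := Submodule.projection_apply_left hC' ⟨_, U.apply_mem_toSubmodule h hu⟩
    have e4 := Submodule.projection_apply_right hC' ⟨_, C.apply_mem_toSubmodule h hc⟩
    simp only at e1 e2 e3 e4
    simp [map_add, e1, e2, e3, e4]

theorem SG_mult_one {G H : Type*} [Group G] [Group H] [Finite H] [Finite G] {V : Type*}
    [AddCommGroup V] [Module ℂ V] [FiniteDimensional ℂ V]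
    (ρ : Representation ℂ G V) [ρ.IsIrreducible] (j : H →* G)
    (hj : ∀ g, ∃ h, j h * g * (j h)⁻¹ = g⁻¹)
    (U : Subrepresentation (ρ.comp j : Representation ℂ H V))
    (f : Representation.IntertwiningMap U.toRepresentation (ρ.comp j : Representation ℂ H V))
    (u : U.toSubmodule) : f u ∈ U.toSubmodule := by
  have := Fintype.ofFinite H
  obtain ⟨p, p1, p2, p3⟩ := SG_retract _ U
  let b : Module.End ℂ V := f.toLinearMap ∘ₗ p.codRestrict U.toSubmodule p1
  have hb : ∀ h, ρ (j h) * b = b * ρ (j h) := by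
    intro h
    ext v
    have := f.isIntertwining _ _ h (⟨p v, p1 v⟩ : U.toSubmodule)
    have e : U.toRepresentation h (⟨p v, p1 v⟩ : U.toSubmodule) = ⟨p (ρ (j h) v), p1 _⟩ := by
      ext
      exact (p3 h v).symm
    rw [e] at this
    exact this.symm
  have hp : ∀ h, ρ (j h) * p = p * ρ (j h) := by
    intro h
    ext v
    exact (p3 h v).symm
  have hc := LinearMap.congr_fun (SG_commute ρ j hj b p hb hp) (u : V)
  have e1 : b u = f u := by
    change f ⟨p u, p1 u⟩ = f u
    congr 1
    ext
    exact p2 _ u.2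
  rw [Module.End.mul_apply, Module.End.mul_apply, p2 _ u.2, e1] at hc
  rw [hc]
  exact p1 _

section
universe u
open Representation

theorem SG_mem_of_atoms {H : Type*} [Group H] [Finite H] {V : Type*} [AddCommGroup V]
    [Module ℂ V] (ρ : Representation ℂ H V) (K : Submodule ℂ V)
    (hK : ∀ S : Subrepresentation ρ, S.toRepresentation.IsIrreducible → S.toSubmodule ≤ K)
    (v : V) : v ∈ K := by
  have : NeZero (Nat.card H : ℂ) := ⟨by exact_mod_cast Nat.card_pos.ne'⟩
  have h1 := IsSemisimpleModule.sSup_simples_eq_top (MonoidAlgebra ℂ H) ρ.asModule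
  rw [sSup_eq_iSup'] at h1
  have hv : (ρ.asModuleEquiv.symm v) ∈ (⊤ : Submodule (MonoidAlgebra ℂ H) ρ.asModule) := trivial
  rw [← h1] at hv
  refine Submodule.iSup_induction _ (motive := fun x => (ρ.asModuleEquiv x) ∈ K) hv ?_ ?_ ?_
  · rintro ⟨N, hN⟩ x hx
    refine hK (Subrepresentation.ofSubmodule' N) ?_ hx
    have hN1 : IsAtom N := isSimpleModule_iff_isAtom.1 hN
    have hN2 : IsAtom (Subrepresentation.ofSubmodule' N) :=
      (Subrepresentation.subrepresentationSubmoduleOrderIso.symm.isAtom_iff N).2 hN1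
    set S := Subrepresentation.ofSubmodule' N
    have hne : ∃ s ∈ S.toSubmodule, s ≠ 0 := by
      apply Submodule.exists_mem_ne_zero_of_ne_bot
      intro h
      exact hN2.1 (Subrepresentation.toSubmodule_injective h)
    obtain ⟨s, hs, hs0⟩ := hne
    refine @IsSimpleOrder.mk _ _ _ ⟨⟨⊥, ⊤, ?_⟩⟩ ?_
    · intro h
      have h2 : (⟨s, hs⟩ : S.toSubmodule) ∈
        (⊥ : Subrepresentation S.toRepresentation).toSubmodule := by rw [h]; trivial
      have h3 : (⟨s, hs⟩ : S.toSubmodule) = 0 := h2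
      exact hs0 (congrArg Subtype.val h3)
    · intro R
      let R' : Subrepresentation ρ :=
        { toSubmodule := R.toSubmodule.map S.toSubmodule.subtype
          apply_mem_toSubmodule := by
            rintro g _ ⟨w, hw, rfl⟩
            exact ⟨_, R.apply_mem_toSubmodule g hw, rfl⟩ }
      have hR' : R' ≤ S := by
        rintro _ ⟨w, hw, rfl⟩
        exact w.2
      rcases hN2.le_iff.1 hR' with h | h
      · left
        apply Subrepresentation.toSubmodule_injective
        have : R'.toSubmodule = ⊥ := by rw [h]; rfl
        change R.toSubmodule = ⊥
        rw [eq_bot_iff]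
        intro w hw
        have hw' : (w : V) ∈ R'.toSubmodule := ⟨w, hw, rfl⟩
        rw [this] at hw'
        exact Subtype.ext hw'
      · right
        apply Subrepresentation.toSubmodule_injective
        have h4 : R'.toSubmodule = S.toSubmodule := by rw [h]
        change R.toSubmodule = ⊤
        rw [eq_top_iff]
        rintro ⟨w, hw⟩ _
        rw [← h4] at hw
        obtain ⟨w', hw', e⟩ := hw
        have : w' = ⟨w, by assumption⟩ := Subtype.ext e
        rw [← this]
        exact hw'
  · exact zero_mem K
  · exact fun x y hx hy => add_mem hx hy

/-- Action of the rational group algebra on a complex representation. -/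
noncomputable def SGop {G : Type*} [Group G] {V : Type*} [AddCommGroup V]
    [Module ℂ V] (ρ : Representation ℂ G V) : MonoidAlgebra ℚ G →+* Module.End ℂ V :=
  (ρ.asAlgebraHom : MonoidAlgebra ℂ G →+* Module.End ℂ V).comp
    (MonoidAlgebra.mapRingHom G (algebraMap ℚ ℂ))

theorem SGop_single {G : Type*} [Group G] {V : Type*} [AddCommGroup V]
    [Module ℂ V] (ρ : Representation ℂ G V) (g : G) (q : ℚ) :
    SGop ρ (MonoidAlgebra.single g q) = (q : ℂ) • ρ g := by
  simp [SGop]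

theorem SGop_comp {G H : Type*} [Group G] [Group H] {V : Type*} [AddCommGroup V]
    [Module ℂ V] (ρ : Representation ℂ G V) (j : H →* G) (x : MonoidAlgebra ℚ H) :
    SGop ρ (MonoidAlgebra.mapDomainRingHom ℚ j x) = SGop (ρ.comp j : Representation ℂ H V) x := by
  induction x using MonoidAlgebra.induction_linear with
  | zero => simp
  | add x y hx hy => simp only [map_add, hx, hy]
  | single g a => simp [SGop_single]

theorem SGop_sub {H : Type*} [Group H] {V : Type*} [AddCommGroup V]
    [Module ℂ V] (ρ : Representation ℂ H V) (S : Subrepresentation ρ) (x : MonoidAlgebra ℚ H)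
    (s : S.toSubmodule) : SGop ρ x s = (SGop S.toRepresentation x s : S.toSubmodule) := by
  induction x using MonoidAlgebra.induction_linear with
  | zero => simp
  | add x y hx hy => simp only [map_add, LinearMap.add_apply, hx, hy]; simp
  | single g a => simp only [SGop_single]; rfl

theorem SG_idem {H : Type*} [Group H] [Finite H] {U : Type u} [AddCommGroup U]
    [Module ℂ U] [FiniteDimensional ℂ U] (σ : Representation ℂ H U) [σ.IsIrreducible]
    (hrat : ∀ h, ∃ q : ℚ, σ.character h = (q : ℂ)) :
    ∃ e : MonoidAlgebra ℚ H, SGop σ e = 1 ∧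
      ∀ (W : Type u) [AddCommGroup W] [Module ℂ W] [FiniteDimensional ℂ W]
        (τ : Representation ℂ H W) [τ.IsIrreducible], IsEmpty (Equiv σ τ) → SGop τ e = 0 := by
  classical
  have := Fintype.ofFinite H
  have hne : (Nat.card H : ℂ) ≠ 0 := by exact_mod_cast Nat.card_pos.ne'
  let _ : Invertible (Nat.card H : ℂ) := invertibleOfNonzero hne
  choose q hq using hrat
  let c : ℚ := Module.finrank ℂ U * (Nat.card H : ℚ)⁻¹
  let e : MonoidAlgebra ℚ H := ∑ h : H, MonoidAlgebra.single h (c * q h⁻¹)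
  have key : ∀ (W : Type u) [AddCommGroup W] [Module ℂ W] [FiniteDimensional ℂ W]
        (τ : Representation ℂ H W) [τ.IsIrreducible], ∃ l : ℂ, SGop τ e = l • 1 ∧
        l * Module.finrank ℂ W = Module.finrank ℂ U * if Nonempty (Equiv σ τ) then 1 else 0 := by
    intro W _ _ _ τ _
    have he : SGop τ e = ∑ h : H, ((c : ℂ) * σ.character h⁻¹) • τ h := by
      simp only [e, map_sum, SGop_single, hq, Rat.cast_mul]
    have hcomm : ∀ g, SGop τ e ∘ₗ τ g = τ g ∘ₗ SGop τ e := by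
      intro g
      rw [he, ← Module.End.mul_eq_comp, ← Module.End.mul_eq_comp, Finset.sum_mul, Finset.mul_sum]
      refine Fintype.sum_bijective (fun h => g⁻¹ * h * g)
        ((Group.mulRight_bijective g).comp (Group.mulLeft_bijective g⁻¹)) _ _ fun h => ?_
      rw [smul_mul_assoc, mul_smul_comm, ← map_mul, ← map_mul]
      have h1 : g * (g⁻¹ * h * g) = h * g := by simp [mul_assoc]
      have h2 : (g⁻¹ * h * g)⁻¹ = g⁻¹ * h⁻¹ * (g⁻¹)⁻¹ := by simp [mul_assoc]
      rw [h1, h2, char_conj]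
    let F : IntertwiningMap τ τ := ⟨SGop τ e, hcomm⟩
    obtain ⟨l, hl⟩ := (IsIrreducible.algebraMap_intertwiningMap_bijective_of_isAlgClosed (ρ := τ)).2 F
    have hl' : SGop τ e = l • 1 := by
      have := congrArg IntertwiningMap.toLinearMap hl
      exact this.symm
    refine ⟨l, hl', ?_⟩
    have ht := congrArg (LinearMap.trace ℂ W) hl'
    rw [map_smul, LinearMap.trace_one, smul_eq_mul] at ht
    rw [← ht, ← char_orthonormal τ σ, he, map_sum, Finset.mul_sum, Finset.mul_sum]
    refine Finset.sum_congr rfl fun h _ => ?_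
    rw [map_smul, smul_eq_mul]
    simp only [c, Representation.character]
    push_cast
    ring
  refine ⟨e, ?_, ?_⟩
  · obtain ⟨l, h1, h2⟩ := key U σ
    rw [if_pos ⟨Representation.Equiv.refl σ⟩, mul_one] at h2
    have : Nontrivial U := IsSimpleModule.nontrivial (MonoidAlgebra ℂ H) σ.asModule
    have h3 : (Module.finrank ℂ U : ℂ) ≠ 0 := by exact_mod_cast Module.finrank_pos.ne'
    rw [h1, (mul_eq_right₀ h3).1 h2, one_smul]
  · intro W _ _ _ τ _ hem
    obtain ⟨l, h1, h2⟩ := key W τ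
    rw [if_neg (by simpa using hem), mul_zero] at h2
    have : Nontrivial W := IsSimpleModule.nontrivial (MonoidAlgebra ℂ H) τ.asModule
    have h3 : (Module.finrank ℂ W : ℂ) ≠ 0 := by exact_mod_cast Module.finrank_pos.ne'
    rw [h1, (mul_eq_zero.1 h2).resolve_right h3, zero_smul]

/-- Every irreducible has a rank one operator coming from the rational group algebra. -/
def SGRankOne (G : Type*) [Group G] : Prop :=
  ∀ (V : Type u) [AddCommGroup V] [Module ℂ V] [FiniteDimensional ℂ V]
    (ρ : Representation ℂ G V) [ρ.IsIrreducible],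
    ∃ (x : MonoidAlgebra ℚ G) (v : V) (ξ : V →ₗ[ℂ] ℂ), v ≠ 0 ∧ ξ ≠ 0 ∧
      ∀ w, SGop ρ x w = ξ w • v

theorem SG_step {G H : Type*} [Group G] [Group H] [Finite H] [Finite G] (j : H →* G)
    (hj : ∀ g, ∃ h, j h * g * (j h)⁻¹ = g⁻¹)
    (hrat : ∀ (V : Type u) [AddCommGroup V] [Module ℂ V] [FiniteDimensional ℂ V]
      (ρ : Representation ℂ H V) (h : H), ∃ q : ℚ, ρ.character h = (q : ℂ))
    (hH : SGRankOne.{u} H) : SGRankOne.{u} G := by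
  intro V _ _ _ ρ _
  have : Nontrivial V := IsSimpleModule.nontrivial (MonoidAlgebra ℂ G) ρ.asModule
  let σ : Representation ℂ H V := ρ.comp j
  obtain ⟨S, hS⟩ : ∃ S : Subrepresentation σ, S.toRepresentation.IsIrreducible := by
    by_contra! hcon
    obtain ⟨v, hv⟩ := exists_ne (0 : V)
    exact hv (SG_mem_of_atoms σ ⊥ (fun S hS => absurd hS (hcon S)) v)
  obtain ⟨y, v, ξ, hv, hξ, hy⟩ := hH S.toSubmodule S.toRepresentation
  obtain ⟨e, he1, he2⟩ := SG_idem S.toRepresentation (hrat _ _)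
  have heS : ∀ w, SGop σ e w ∈ S.toSubmodule := by
    intro w
    refine SG_mem_of_atoms σ (S.toSubmodule.comap (SGop σ e)) ?_ w
    intro R hR r hr
    change SGop σ e r ∈ S.toSubmodule
    have h0 := SGop_sub σ R e ⟨r, hr⟩
    simp only at h0
    rw [h0]
    by_cases hem : IsEmpty (Equiv S.toRepresentation R.toRepresentation)
    · rw [he2 _ _ hem]
      simp
    · rw [not_isEmpty_iff] at hem
      obtain ⟨φ⟩ := hem
      obtain ⟨s, hs⟩ := φ.toLinearEquiv.surjective (SGop R.toRepresentation e ⟨r, hr⟩)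
      rw [← hs]
      let f : IntertwiningMap S.toRepresentation (ρ.comp j : Representation ℂ H V) :=
        ⟨R.toSubmodule.subtype ∘ₗ φ.toLinearMap, by
          intro g
          ext s
          exact congrArg Subtype.val (φ.toIntertwiningMap.isIntertwining _ _ g s)⟩
      exact SG_mult_one ρ j hj S f s
  refine ⟨MonoidAlgebra.mapDomainRingHom ℚ j (y * e), v,
    ξ ∘ₗ (SGop σ e).codRestrict S.toSubmodule heS, ?_, ?_, ?_⟩
  · simpa using hv
  · intro h0
    apply hξ
    ext s
    have h1 := LinearMap.congr_fun h0 (s : V)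
    have h2 : (SGop σ e).codRestrict S.toSubmodule heS s = s := by
      ext
      change SGop σ e s = s
      rw [SGop_sub, he1]
      rfl
    rw [LinearMap.comp_apply, h2] at h1
    exact h1
  · intro w
    rw [SGop_comp, map_mul, Module.End.mul_apply]
    have h1 := SGop_sub σ S y ⟨_, heS w⟩
    simp only at h1
    rw [h1, hy]
    rfl

theorem SG_rankOne_perm (n : ℕ) : ∀ (α : Type) [Finite α], Nat.card α = n →
    SGRankOne.{u} (Equiv.Perm α) := by
  induction n with
  | zero =>
    intro α _ hα V _ _ _ ρ _
    have hem : IsEmpty α := by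
      rcases Nat.card_eq_zero.1 hα with h | h
      · exact h
      · exact absurd ‹Finite α› (by simpa using h)
    have : IsMulCommutative (Equiv.Perm α) := ⟨⟨fun a b => Subsingleton.elim _ _⟩⟩
    have h1 := IsIrreducible.finrank_eq_one_of_isMulCommutative ρ
    let b := Module.basisUnique Unit h1
    refine ⟨1, b (), b.coord (), b.ne_zero _, ?_, ?_⟩
    · intro h
      simpa using LinearMap.congr_fun h (b ())
    · intro w
      have := b.sum_repr w
      simpa using this.symm
  | succ n ih =>
    intro α _ hα
    classical
    have : Nonempty α := (Nat.card_pos_iff.1 (by omega)).1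
    have := Fintype.ofFinite α
    let x : α := Classical.arbitrary α
    have hβ : Nat.card {y : α // y ≠ x} = n := by
      rw [Nat.card_eq_fintype_card] at hα ⊢
      simp [hα]
    refine SG_step (Equiv.Perm.ofSubtype : Equiv.Perm {y : α // y ≠ x} →* Equiv.Perm α) ?_
      (fun V _ _ _ ρ h => SG_char_rat ρ h) (ih _ hβ)
    intro g
    obtain ⟨t, ht, htg⟩ := SG_conj_fix g g⁻¹ (-1) (-1) (by simp) (by simp) x
    have h1 : ∀ y, t y ≠ x ↔ y ≠ x := by
      intro y
      rw [not_iff_not]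
      exact ⟨fun h => t.injective (h.trans ht.symm), fun h => h ▸ ht⟩
    refine ⟨t.subtypePerm h1, ?_⟩
    rw [Equiv.Perm.ofSubtype_subtypePerm]
    · exact htg
    · rintro y hy rfl
      exact hy ht

end

section
universe u
open Representation

theorem SG_real_of_rankOne {G : Type*} [Group G] [Finite G] {V : Type u} [AddCommGroup V]
    [Module ℂ V] [FiniteDimensional ℂ V] (ρ : Representation ℂ G V) [ρ.IsIrreducible]
    (hrat : ∀ g, ∃ q : ℚ, ρ.character g = (q : ℂ)) (hG : SGRankOne.{u} G) :
    ∃ (ι : Type u) (_ : Fintype ι) (b : Module.Basis ι ℂ V), ∀ g i j,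
    ∃ q : ℚ, b.repr (ρ g (b i)) j = (q : ℂ) := by
  classical
  obtain ⟨x, v, ξ, hv, hξ, hx⟩ := hG V ρ
  -- the pairing is rational
  have hpair : ∀ g, ∃ q : ℚ, ξ (ρ g v) = (q : ℂ) := by
    intro g
    have h1 : LinearMap.trace ℂ V (ρ g * SGop ρ x) = ξ (ρ g v) := by
      have : ρ g * SGop ρ x = ξ.smulRight (ρ g v) := by
        ext w
        simp [hx]
      rw [this]
      simp
    rw [← h1]
    clear h1 hx
    induction x using MonoidAlgebra.induction_linear with
    | zero => exact ⟨0, by simp⟩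
    | add x y hx hy =>
      obtain ⟨a, ha⟩ := hx
      obtain ⟨b, hb⟩ := hy
      exact ⟨a + b, by rw [map_add, mul_add, map_add, ha, hb]; push_cast; rfl⟩
    | single k a =>
      obtain ⟨q, hq⟩ := hrat (g * k)
      refine ⟨a * q, ?_⟩
      rw [SGop_single, mul_smul_comm, ← map_mul, map_smul]
      push_cast
      rw [← hq]
      rfl
  -- the orbit of `v` spans
  have hspan : (⊤ : Submodule ℂ V) ≤ Submodule.span ℂ (Set.range fun g => ρ g v) := by
    let R : Subrepresentation ρ :=
      { toSubmodule := Submodule.span ℂ (Set.range fun g => ρ g v)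
        apply_mem_toSubmodule := by
          intro g w hw
          induction hw using Submodule.span_induction with
          | mem y hy =>
            obtain ⟨k, rfl⟩ := hy
            exact Submodule.subset_span ⟨g * k, by simp⟩
          | zero => simp
          | add y z _ _ hy hz => rw [map_add]; exact add_mem hy hz
          | smul a y _ hy => rw [map_smul]; exact Submodule.smul_mem _ a hy }
    rcases eq_bot_or_eq_top R with h | h
    · exfalso
      have hvR : v ∈ R.toSubmodule := Submodule.subset_span ⟨1, by simp⟩
      rw [h] at hvR
      exact hv hvR
    · have : R.toSubmodule = ⊤ := by rw [h]; rfl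
      exact this.ge
  -- separation
  have hsep : ∀ w, (∀ g, ξ (ρ g w) = 0) → w = 0 := by
    let R : Subrepresentation ρ :=
      { toSubmodule := ⨅ g, LinearMap.ker (ξ ∘ₗ ρ g)
        apply_mem_toSubmodule := by
          intro g w hw
          simp only [Submodule.mem_iInf, LinearMap.mem_ker, LinearMap.comp_apply] at hw ⊢
          intro k
          rw [← Module.End.mul_apply, ← map_mul]
          exact hw _ }
    intro w hw
    have hwR : w ∈ R.toSubmodule := by
      simpa [R] using hw
    rcases eq_bot_or_eq_top R with h | h
    · rw [h] at hwR
      exact hwR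
    · exfalso
      apply hξ
      ext u
      have hu : u ∈ R.toSubmodule := by rw [h]; trivial
      simp only [R, Submodule.mem_iInf, LinearMap.mem_ker, LinearMap.comp_apply] at hu
      simpa using hu 1
  let b := Module.Basis.ofSpan hspan
  refine ⟨_, FiniteDimensional.fintypeBasisIndex b, b, ?_⟩
  let _ := FiniteDimensional.fintypeBasisIndex b
  have hb : ∀ i, ∃ g, ρ g v = b i := fun i =>
    Module.Basis.ofSpan_subset hspan ⟨i, rfl⟩
  -- a rational retraction
  obtain ⟨π, hπ⟩ : ∃ π : ℂ →ₗ[ℚ] ℚ, ∀ q : ℚ, π (q : ℂ) = q := by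
    obtain ⟨π, hπ⟩ := LinearMap.exists_leftInverse_of_injective (Algebra.linearMap ℚ ℂ)
      (LinearMap.ker_eq_bot.2 (algebraMap ℚ ℂ).injective)
    exact ⟨π, fun q => by simpa using LinearMap.congr_fun hπ q⟩
  intro g i
  set w := ρ g (b i) with hw
  let w' : V := ∑ k, ((π (b.repr w k) : ℚ) : ℂ) • b k
  have hww : w = w' := by
    rw [← sub_eq_zero]
    apply hsep
    intro k
    rw [map_sub, map_sub, sub_eq_zero]
    have h1 : ∀ l, ∃ q : ℚ, ξ (ρ k (b l)) = (q : ℂ) := by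
      intro l
      obtain ⟨m, hm⟩ := hb l
      rw [← hm, ← Module.End.mul_apply, ← map_mul]
      exact hpair _
    choose r hr using h1
    have h2 : ξ (ρ k w') = ((∑ l, π (b.repr w l) * r l : ℚ) : ℂ) := by
      simp [w', map_sum, hr]
    have h3 : ξ (ρ k w) = ∑ l, b.repr w l * r l := by
      refine (congrArg (fun z => ξ (ρ k z)) (b.sum_repr w).symm).trans ?_
      simp only [map_sum, map_smul, hr, smul_eq_mul]
    obtain ⟨q, hq⟩ : ∃ q : ℚ, ξ (ρ k w) = (q : ℂ) := by
      obtain ⟨m, hm⟩ := hb i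
      rw [hw, ← hm, ← Module.End.mul_apply, ← Module.End.mul_apply, ← map_mul, ← map_mul]
      exact hpair _
    have h4 : π (ξ (ρ k w)) = ∑ l, π (b.repr w l) * r l := by
      rw [h3, map_sum]
      refine Finset.sum_congr rfl fun l _ => ?_
      have : b.repr w l * (r l : ℂ) = (r l) • b.repr w l := by
        rw [Rat.smul_def, mul_comm]
      rw [this, map_smul, smul_eq_mul, mul_comm]
    rw [h2, ← h4, hq, hπ]
  intro l
  refine ⟨π (b.repr w l), ?_⟩
  have : b.repr w l = b.repr w' l := by rw [← hww]
  rw [this]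
  simp only [w']
  rw [b.repr_sum_self (fun k => ((π (b.repr w k) : ℚ) : ℂ))]
  simp only [hπ]

theorem SG_real {G : Type*} [Group G] [Finite G]
    (hrat : ∀ (V : Type u) [AddCommGroup V] [Module ℂ V] [FiniteDimensional ℂ V]
      (ρ : Representation ℂ G V) (h : G), ∃ q : ℚ, ρ.character h = (q : ℂ))
    (hG : SGRankOne.{u} G) (n : ℕ) :
    ∀ (V : Type u) [AddCommGroup V] [Module ℂ V] [FiniteDimensional ℂ V]
      (ρ : Representation ℂ G V), Module.finrank ℂ V = n →
    ∃ (ι : Type u) (_ : Fintype ι) (b : Module.Basis ι ℂ V), ∀ g i j,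
    ∃ q : ℚ, b.repr (ρ g (b i)) j = (q : ℂ) := by
  induction n using Nat.strong_induction_on with
  | _ n ih =>
  intro V _ _ _ ρ hn
  rcases subsingleton_or_nontrivial V with hV | hV
  · exact ⟨PEmpty, inferInstance, Module.Basis.empty V, fun g i => i.elim⟩
  obtain ⟨S, hS⟩ : ∃ S : Subrepresentation ρ, S.toRepresentation.IsIrreducible := by
    by_contra! hcon
    obtain ⟨v, hv⟩ := exists_ne (0 : V)
    exact hv (SG_mem_of_atoms ρ ⊥ (fun S hS => absurd hS (hcon S)) v)
  have : NeZero (Nat.card G : ℂ) := ⟨by exact_mod_cast Nat.card_pos.ne'⟩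
  obtain ⟨C, hC⟩ := exists_isCompl S
  have hC' : IsCompl S.toSubmodule C.toSubmodule := by
    constructor
    · rw [disjoint_iff]
      exact congrArg Subrepresentation.toSubmodule (disjoint_iff.1 hC.1)
    · rw [codisjoint_iff]
      exact congrArg Subrepresentation.toSubmodule (codisjoint_iff.1 hC.2)
  have : Nontrivial S.toSubmodule :=
    IsSimpleModule.nontrivial (MonoidAlgebra ℂ G) S.toRepresentation.asModule
  have hpos : 0 < Module.finrank ℂ S.toSubmodule := Module.finrank_pos
  have hadd := Submodule.finrank_add_eq_of_isCompl hC'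
  obtain ⟨ι, _, b, hb⟩ := SG_real_of_rankOne S.toRepresentation (hrat _ _) hG
  obtain ⟨κ, _, c, hc⟩ := ih _ (by omega) C.toSubmodule C.toRepresentation rfl
  let E := Submodule.prodEquivOfIsCompl _ _ hC'
  refine ⟨ι ⊕ κ, inferInstance, (b.prod c).map E, ?_⟩
  have hE : ∀ g (p : S.toSubmodule × C.toSubmodule), E.symm (ρ g (E p)) =
      (S.toRepresentation g p.1, C.toRepresentation g p.2) := by
    intro g p
    rw [LinearEquiv.symm_apply_eq]
    simp only [E, Submodule.coe_prodEquivOfIsCompl', map_add]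
    rfl
  intro g i k
  simp only [Module.Basis.map_repr, Module.Basis.map_apply, LinearEquiv.trans_apply, hE]
  rcases i with i | i <;> rcases k with k | k
  · simpa using hb g i k
  · exact ⟨0, by simp⟩
  · exact ⟨0, by simp⟩
  · simpa using hc g i k

end

open scoped TensorProduct

/-- For every `n ≥ 1`, every finite-dimensional complex representation of the
symmetric group `S n` can be realized over `ℚ`: it is isomorphic to the complexification of a
representation on a finite-dimensional `ℚ`-vector space. -/
theorem symmetricGroup_representation_realizable_over_rat (n : ℕ) (hn : 1 ≤ n)
    (φ : FDRep ℂ (Equiv.Perm (Fin n))) :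
    ∃ W : Rep ℚ (Equiv.Perm (Fin n)), FiniteDimensional ℚ W ∧
      ∃ e : (ℂ ⊗[ℚ] W) ≃ₗ[ℂ] φ,
        ∀ (g : Equiv.Perm (Fin n)) (x : ℂ ⊗[ℚ] W),
          e (LinearMap.baseChange ℂ (W.ρ g) x) = φ.ρ g (e x) := by
  classical
  obtain ⟨ι, _, b, hb⟩ := SG_real (fun V _ _ _ ρ h => SG_char_rat ρ h)
    (SG_rankOne_perm n (Fin n) (by simp)) _ φ φ.ρ rfl
  choose q hq using hb
  let M : Equiv.Perm (Fin n) → Matrix ι ι ℚ := fun g => Matrix.of fun k i => q g i k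
  have hM : ∀ g, (M g).map (algebraMap ℚ ℂ) = LinearMap.toMatrix b b (φ.ρ g) := by
    intro g
    ext k i
    simp [M, LinearMap.toMatrix_apply, hq]
  have hinj : Function.Injective (fun A : Matrix ι ι ℚ => A.map (algebraMap ℚ ℂ)) :=
    Matrix.map_injective (algebraMap ℚ ℂ).injective
  let σ : Representation ℚ (Equiv.Perm (Fin n)) (ULift (ι → ℚ)) :=
    { toFun := fun g => (ULift.moduleEquiv.symm.conj (Matrix.toLin' (M g)))
      map_one' := by
        have : M 1 = 1 := by
          apply hinj
          simp only [hM]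
          simp
        rw [this, Matrix.toLin'_one]
        ext; rfl
      map_mul' := by
        intro g h
        have : M (g * h) = M g * M h := by
          apply hinj
          simp only [hM, Matrix.map_mul, map_mul]
          rw [LinearMap.toMatrix_mul]
        rw [this, Matrix.toLin'_mul]
        ext; rfl }
  let B : Module.Basis ι ℚ (ULift (ι → ℚ)) := (Pi.basisFun ℚ ι).map ULift.moduleEquiv.symm
  have hσ : ∀ g i, σ g (B i) = ∑ k, q g i k • B k := by
    intro g i
    apply (ULift.moduleEquiv (R := ℚ) (M := ι → ℚ)).injective
    rw [map_sum]
    simp only [map_smul, B, Module.Basis.map_apply, LinearEquiv.apply_symm_apply]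
    change Matrix.toLin' (M g) (Pi.basisFun ℚ ι i) = _
    ext k
    simp [M, Pi.basisFun_apply, Finset.sum_apply, Pi.single_apply]
  refine ⟨Rep.of σ, ?_, ?_⟩
  · exact Module.Finite.of_basis B
  let BC : Module.Basis ι ℂ (ℂ ⊗[ℚ] (ULift (ι → ℚ))) := B.baseChange ℂ
  let e : (ℂ ⊗[ℚ] (ULift (ι → ℚ))) ≃ₗ[ℂ] φ := BC.equiv b (Equiv.refl ι)
  have he : ∀ i, e (1 ⊗ₜ B i) = b i := by
    intro i
    have := BC.equiv_apply i b (Equiv.refl ι)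
    simpa [BC] using this
  refine ⟨e, ?_⟩
  intro g x
  have hcomp : e.toLinearMap ∘ₗ LinearMap.baseChange ℂ (σ g) = φ.ρ g ∘ₗ e.toLinearMap := by
    apply BC.ext
    intro i
    simp only [BC, Module.Basis.baseChange_apply, LinearMap.comp_apply,
      LinearMap.baseChange_tmul, LinearEquiv.coe_coe, he, hσ, TensorProduct.tmul_sum, map_sum,
      TensorProduct.tmul_smul]
    conv_rhs => rw [← b.sum_repr (φ.ρ g (b i))]
    refine Finset.sum_congr rfl fun k _ => ?_
    rw [hq, ← he k, ← map_smul]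
    congr 1
  exact LinearMap.congr_fun hcomp x
end

section
/- Let V be a 2-dimensional complex vector space and W a finite subgroup of GL(V) such that the tautological action of W on V is irreducible and W is generated by its pseudo-reflections (elements g ∈ W with g ≠ 1 whose fixed subspace ker(g − 1) is 1-dimensional). Then the representation ring R(W) is generated by the tautological representation V together with the 1-dimensional representations: every irreducible character of W lies in the subring of the ring of class functions on W generated by the character of the inclusion W ↪ GL(V) together with all group homomorphisms W → ℂ^×. -/
namespace RankTwo
open MvPolynomial

/-- The polynomial ring in two variables. -/
abbrev S := MvPolynomial (Fin 2) ℂ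

/-- Its homogeneous pieces. -/
abbrev H (n : ℕ) : Submodule ℂ S := homogeneousSubmodule (Fin 2) ℂ n

instance finH (n : ℕ) : FiniteDimensional ℂ (H n) :=
  Module.Finite.iff_fg.mpr (homogeneousSubmodule_fg (R := ℂ) (σ := Fin 2) n)

lemma tcc {A B : Type*} [AddCommGroup A] [Module ℂ A] [AddCommGroup B] [Module ℂ B]
    [FiniteDimensional ℂ A] [FiniteDimensional ℂ B] (f : A →ₗ[ℂ] B) (g : B →ₗ[ℂ] A) :
    LinearMap.trace ℂ B (f ∘ₗ g) = LinearMap.trace ℂ A (g ∘ₗ f) :=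
  LinearMap.trace_comp_comm' g f

/-- Additivity of the trace on short exact sequences. -/
lemma trace_exact {A B C : Type*} [AddCommGroup A] [Module ℂ A] [AddCommGroup B] [Module ℂ B]
    [AddCommGroup C] [Module ℂ C] [FiniteDimensional ℂ A] [FiniteDimensional ℂ B]
    [FiniteDimensional ℂ C] (i : A →ₗ[ℂ] B) (p : B →ₗ[ℂ] C) (hi : Function.Injective i)
    (hp : Function.Surjective p) (hip : ∀ b, p b = 0 ↔ ∃ a, i a = b)
    (a : A →ₗ[ℂ] A) (b : B →ₗ[ℂ] B) (c : C →ₗ[ℂ] C)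
    (h1 : ∀ x, b (i x) = i (a x)) (h2 : ∀ x, p (b x) = c (p x)) :
    LinearMap.trace ℂ B b = LinearMap.trace ℂ A a + LinearMap.trace ℂ C c := by
  obtain ⟨s, hs⟩ := p.exists_rightInverse_of_surjective (LinearMap.range_eq_top.mpr hp)
  obtain ⟨r, hr⟩ := i.exists_leftInverse_of_injective (LinearMap.ker_eq_bot.mpr hi)
  have hs' : ∀ x, p (s x) = x := fun x => LinearMap.congr_fun hs x
  have hr' : ∀ x, r (i x) = x := fun x => LinearMap.congr_fun hr x
  have key : b = (i ∘ₗ a) ∘ₗ (r ∘ₗ (LinearMap.id - s ∘ₗ p)) + (b ∘ₗ s) ∘ₗ p := by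
    ext x
    obtain ⟨y, hy⟩ := (hip (x - s (p x))).mp (by simp [hs'])
    simp only [LinearMap.add_apply, LinearMap.comp_apply, LinearMap.sub_apply, LinearMap.id_apply]
    rw [← hy, hr', ← h1, hy, map_sub]
    abel
  rw [key, map_add, tcc (i ∘ₗ a), tcc (b ∘ₗ s)]
  congr 2
  · ext x
    have : p (i (a x)) = 0 := (hip _).mpr ⟨_, rfl⟩
    simp [this, hr']
  · ext x
    simp [h2, hs']

lemma trace_iso {A B : Type*} [AddCommGroup A] [Module ℂ A] [AddCommGroup B] [Module ℂ B]
    [FiniteDimensional ℂ A] [FiniteDimensional ℂ B]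
    (i : A →ₗ[ℂ] B) (hi : Function.Bijective i)
    (a : A →ₗ[ℂ] A) (b : B →ₗ[ℂ] B) (h1 : ∀ x, b (i x) = i (a x)) :
    LinearMap.trace ℂ B b = LinearMap.trace ℂ A a := by
  have := LinearMap.trace_conj' a (LinearEquiv.ofBijective i hi)
  rw [← this]
  congr 1
  ext x
  obtain ⟨y, rfl⟩ := hi.2 x
  rw [h1]
  simp [LinearEquiv.conj_apply]

/-- block endomorphism -/
noncomputable def blk {E : Type*} [AddCommGroup E] [Module ℂ E] (a b c d : ℂ) (A : E →ₗ[ℂ] E) :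
    E × E →ₗ[ℂ] E × E :=
    LinearMap.inl ℂ E E ∘ₗ ((a • A) ∘ₗ LinearMap.fst ℂ E E) +
    LinearMap.inl ℂ E E ∘ₗ ((b • A) ∘ₗ LinearMap.snd ℂ E E) +
    LinearMap.inr ℂ E E ∘ₗ ((c • A) ∘ₗ LinearMap.fst ℂ E E) +
    LinearMap.inr ℂ E E ∘ₗ ((d • A) ∘ₗ LinearMap.snd ℂ E E)

lemma trace_blk {E : Type*} [AddCommGroup E] [Module ℂ E] [FiniteDimensional ℂ E] (a b c d : ℂ)
    (A : E →ₗ[ℂ] E) :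
    LinearMap.trace ℂ (E × E) (blk a b c d A) = (a + d) * LinearMap.trace ℂ E A := by
  simp only [blk, map_add]
  rw [tcc (LinearMap.inl ℂ E E), tcc (LinearMap.inl ℂ E E), tcc (LinearMap.inr ℂ E E),
    tcc (LinearMap.inr ℂ E E)]
  simp only [LinearMap.comp_assoc, LinearMap.fst_comp_inl, LinearMap.snd_comp_inl,
    LinearMap.fst_comp_inr, LinearMap.snd_comp_inr, LinearMap.comp_id, LinearMap.comp_zero,
    map_zero, map_smul, smul_eq_mul]
  ring

/-- substitution by a matrix -/
noncomputable def act (m : Matrix (Fin 2) (Fin 2) ℂ) : S →ₐ[ℂ] S :=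
  aeval (fun j => ∑ i, C (m i j) * X i)

lemma act_X (m : Matrix (Fin 2) (Fin 2) ℂ) (j : Fin 2) :
    act m (X j) = C (m 0 j) * X 0 + C (m 1 j) * X 1 := by
  simp [act, Fin.sum_univ_two]

lemma act_one : act 1 = AlgHom.id ℂ S := by
  ext j : 1
  rw [act_X]
  fin_cases j <;> simp [Matrix.one_apply]

lemma act_mul (m n : Matrix (Fin 2) (Fin 2) ℂ) : act (m * n) = (act m).comp (act n) := by
  ext j : 1
  simp only [AlgHom.comp_apply, act_X, map_add, map_mul, algHom_C, algebraMap_eq,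
    Matrix.mul_apply, Fin.sum_univ_two]
  ring

lemma act_mem (m : Matrix (Fin 2) (Fin 2) ℂ) {n : ℕ} {p : S} (hp : p ∈ H n) : act m p ∈ H n := by
  rw [mem_homogeneousSubmodule] at *
  have := hp.aeval (fun j => ∑ i, C (m i j) * X i) (n := 1) (fun j =>
    IsHomogeneous.sum _ _ _ fun i _ => isHomogeneous_C_mul_X _ _)
  simpa [act] using this

/-- action on homogeneous polynomials -/
noncomputable def actH (m : Matrix (Fin 2) (Fin 2) ℂ) (n : ℕ) : H n →ₗ[ℂ] H n :=
  (act m).toLinearMap.restrict (fun _ hp => act_mem m hp)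

lemma actH_coe (m : Matrix (Fin 2) (Fin 2) ℂ) (n : ℕ) (p : H n) :
    (actH m n p : S) = act m p := rfl

/-- multiplication by a homogeneous polynomial -/
noncomputable def mulH (a : S) {p : ℕ} (ha : a ∈ H p) (n k : ℕ) (h : p + n = k) : H n →ₗ[ℂ] H k :=
  (LinearMap.mulLeft ℂ a).restrict (fun x hx => by
    subst h
    exact IsHomogeneous.mul ha hx)

lemma mulH_coe (a : S) {p : ℕ} (ha : a ∈ H p) (n k : ℕ) (h : p + n = k) (x : H n) :
    (mulH a ha n k h x : S) = a * x := rfl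

lemma hom_comp_mul {a q : S} {p : ℕ} (ha : a ∈ H p) (n : ℕ) :
    homogeneousComponent (p + n) (a * q) = a * homogeneousComponent n q := by
  conv_lhs => rw [← sum_homogeneousComponent q, Finset.mul_sum, map_sum]
  have : ∀ i, homogeneousComponent (p + n) (a * homogeneousComponent i q)
      = if n = i then a * homogeneousComponent i q else 0 := by
    intro i
    rw [homogeneousComponent_of_mem (n := p + i)
      (IsHomogeneous.mul ha (homogeneousComponent_isHomogeneous i q))]
    simp
  simp_rw [this]
  rw [Finset.sum_ite_eq]
  split_ifs with h
  · rfl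
  · rw [homogeneousComponent_eq_zero, mul_zero]
    simp at h
    omega

lemma hom_comp_mul_lt {a q : S} {p : ℕ} (ha : a ∈ H p) (n : ℕ) (hn : n < p) :
    homogeneousComponent n (a * q) = 0 := by
  conv_lhs => rw [← sum_homogeneousComponent q, Finset.mul_sum, map_sum]
  refine Finset.sum_eq_zero fun i _ => ?_
  rw [homogeneousComponent_of_mem (n := p + i)
      (IsHomogeneous.mul ha (homogeneousComponent_isHomogeneous i q)), if_neg]
  omega

lemma cofactor {a q : S} {p n : ℕ} (ha : a ∈ H p) (h0 : a ≠ 0) (h : a * q ∈ H (p + n)) :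
    q ∈ H n := by
  have h1 := hom_comp_mul (q := q) ha n
  rw [homogeneousComponent_eq_self h] at h1
  rw [mul_left_cancel₀ h0 h1]
  exact homogeneousComponent_mem _ _

lemma cofactor_lt {a q : S} {p n : ℕ} (ha : a ∈ H p) (h : a * q ∈ H n) (hn : n < p) :
    a * q = 0 := by
  rw [← homogeneousComponent_eq_self h]
  exact hom_comp_mul_lt ha n hn

lemma X_isRelPrime : IsRelPrime (X 0 : S) (X 1) := by
  have h0 : Prime (X 0 : S) := X_prime
  rw [h0.irreducible.isRelPrime_iff_not_dvd]
  intro h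
  rw [X_dvd_iff_modMonomial_eq_zero] at h
  have := congrArg (coeff (Finsupp.single 1 1)) h
  simp at this

lemma exists_split (n : ℕ) {z : S} (hz : z ∈ H (n + 2)) :
    ∃ u ∈ H (n+1), ∃ v ∈ H (n+1), z = X 0 * u + X 1 * v := by
  have : H (n+2) = H 1 * H (n+1) := by
    unfold H
    have h (k : ℕ) := homogeneousSubmodule_one_pow (σ := Fin 2) (R := ℂ) k
    rw [← h (n+2), ← h (n+1), ← pow_succ']
  rw [this] at hz
  induction hz using Submodule.mul_induction_on' with
  | mem_mul_mem a ha b hb =>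
    have ha' : a ∈ Submodule.span ℂ (Set.range (X : Fin 2 → S)) := by
      rw [← homogeneousSubmodule_one_eq_span_X]; exact ha
    obtain ⟨c, hc⟩ := (Submodule.mem_span_range_iff_exists_fun ℂ).mp ha'
    rw [Fin.sum_univ_two] at hc
    refine ⟨c 0 • b, Submodule.smul_mem _ _ hb, c 1 • b, Submodule.smul_mem _ _ hb, ?_⟩
    rw [← hc, add_mul]
    simp only [smul_mul_assoc, mul_smul_comm]
  | add x _ y _ h1 h2 =>
    obtain ⟨u, hu, v, hv, rfl⟩ := h1
    obtain ⟨u', hu', v', hv', rfl⟩ := h2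
    exact ⟨u + u', add_mem hu hu', v + v', add_mem hv hv', by ring⟩

lemma trace_actH_rec (m : Matrix (Fin 2) (Fin 2) ℂ) (n : ℕ) :
    LinearMap.trace ℂ (H (n+2)) (actH m (n+2)) =
      m.trace * LinearMap.trace ℂ (H (n+1)) (actH m (n+1))
      - m.det * LinearMap.trace ℂ (H n) (actH m n) := by
  have hX : ∀ i : Fin 2, (X i : S) ∈ H 1 := fun i => isHomogeneous_X _ _
  let x (i : Fin 2) (n : ℕ) := mulH (X i) (hX i) n (n+1) (add_comm _ _)
  let i : H n →ₗ[ℂ] H (n+1) × H (n+1) := LinearMap.prod (x 1 n) (-x 0 n)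
  let p : H (n+1) × H (n+1) →ₗ[ℂ] H (n+2) := LinearMap.coprod (x 0 (n+1)) (x 1 (n+1))
  let A := actH m (n+1)
  let b := blk (m 0 0) (m 0 1) (m 1 0) (m 1 1) A
  have hb : LinearMap.trace ℂ _ b = m.trace * LinearMap.trace ℂ _ A := by
    rw [Matrix.trace_fin_two]; exact trace_blk _ _ _ _ A
  have := trace_exact i p ?_ ?_ ?_ (m.det • actH m n) b (actH m (n+2)) ?_ ?_
  · rw [hb, map_smul, smul_eq_mul] at this
    rw [this]; ring
  · intro u v huv
    have h1 := congrArg (fun z => (z.1 : S)) huv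
    simp only [i, LinearMap.prod_apply, x] at h1
    exact Subtype.ext (mul_left_cancel₀ (X_ne_zero _) h1)
  · intro z
    obtain ⟨u, hu, v, hv, h⟩ := exists_split n z.2
    exact ⟨(⟨u, hu⟩, ⟨v, hv⟩), Subtype.ext h.symm⟩
  · rintro ⟨u, v⟩
    constructor
    · intro h
      have h1 := congrArg Subtype.val h
      simp only [p, LinearMap.coprod_apply, x, Submodule.coe_add, mulH_coe, Submodule.coe_zero] at h1
      have h2 : (X 1 : S) ∣ X 0 * (u : S) := ⟨-(v : S), by linear_combination h1⟩
      obtain ⟨w, hw⟩ := X_isRelPrime.symm.dvd_of_dvd_mul_left h2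
      have hw' : w ∈ H n := by
        apply cofactor (hX 1) (X_ne_zero _)
        rw [← hw, add_comm]
        exact u.2
      refine ⟨⟨w, hw'⟩, ?_⟩
      have h3 : (v : S) = - (X 0 * w) := by
        apply mul_left_cancel₀ (X_ne_zero (1 : Fin 2) : (X 1 : S) ≠ 0)
        rw [hw] at h1
        linear_combination h1
      ext1 <;> apply Subtype.ext
      · simp [i, x, mulH_coe, hw]
      · simp [i, x, mulH_coe, h3]
    · rintro ⟨w, hw⟩
      rw [← hw]
      apply Subtype.ext
      simp [p, i, x, mulH_coe]
      ring
  · intro r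
    ext1 <;> apply Subtype.ext <;>
    · simp [b, blk, i, x, A, mulH_coe, actH_coe, act_X, smul_eq_C_mul, Matrix.det_fin_two]
      ring
  · rintro ⟨u, v⟩
    apply Subtype.ext
    simp [b, blk, p, x, A, mulH_coe, actH_coe, act_X, smul_eq_C_mul]
    ring

end RankTwo


namespace RankTwo
open MvPolynomial

lemma trace_actH_zero (m : Matrix (Fin 2) (Fin 2) ℂ) :
    LinearMap.trace ℂ (H 0) (actH m 0) = 1 := by
  let i : ℂ →ₗ[ℂ] H 0 := LinearMap.codRestrict (H 0) (Algebra.linearMap ℂ S)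
    (fun c => isHomogeneous_C _ c)
  have hi : ∀ c, (i c : S) = C c := fun c => rfl
  rw [trace_iso i ⟨?_, ?_⟩ LinearMap.id]
  · simp
  · intro x
    apply Subtype.ext
    simp [actH_coe, hi]
  · intro x y h
    have := congrArg Subtype.val h
    rw [hi, hi] at this
    exact C_injective _ _ this
  · intro z
    refine ⟨coeff 0 (z : S), Subtype.ext ?_⟩
    rw [hi, ← homogeneousComponent_zero]
    exact homogeneousComponent_eq_self z.2

lemma mem_H_one {z : S} (hz : z ∈ H 1) : ∃ c : Fin 2 → ℂ, z = c 0 • X 0 + c 1 • X 1 := by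
  have ha' : z ∈ Submodule.span ℂ (Set.range (X : Fin 2 → S)) := by
    rw [← homogeneousSubmodule_one_eq_span_X]; exact hz
  obtain ⟨c, hc⟩ := (Submodule.mem_span_range_iff_exists_fun ℂ).mp ha'
  rw [Fin.sum_univ_two] at hc
  exact ⟨c, hc.symm⟩

lemma X_mem (i : Fin 2) : (X i : S) ∈ H 1 := isHomogeneous_X _ _

lemma trace_actH_one (m : Matrix (Fin 2) (Fin 2) ℂ) :
    LinearMap.trace ℂ (H 1) (actH m 1) = m.trace := by
  let i : (Fin 2 → ℂ) →ₗ[ℂ] H 1 := Fintype.linearCombination ℂ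
    (fun i => (⟨X i, X_mem i⟩ : H 1))
  have hi : ∀ c, (i c : S) = C (c 0) * X 0 + C (c 1) * X 1 := fun c => by
    simp [i, Fintype.linearCombination_apply, smul_eq_C_mul]
  rw [trace_iso i ⟨?_, ?_⟩ (Matrix.toLin' m)]
  · simp
  · intro x
    apply Subtype.ext
    simp [actH_coe, hi, act_X, Matrix.mulVec, dotProduct, Fin.sum_univ_two]
    ring
  · intro x y h
    have := congrArg Subtype.val h
    rw [hi, hi] at this
    have h0 := congrArg (coeff (Finsupp.single 0 1)) this
    have h1 := congrArg (coeff (Finsupp.single 1 1)) this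
    simp [coeff_C_mul, coeff_X, Finsupp.single_left_inj] at h0 h1
    ext j
    fin_cases j
    · exact h0
    · exact h1
  · intro z
    obtain ⟨c, hc⟩ := mem_H_one z.2
    refine ⟨c, Subtype.ext ?_⟩
    rw [hi, hc]
    simp [smul_eq_C_mul]

lemma finrank_H (n : ℕ) : Module.finrank ℂ (H n) = n + 1 := by
  have key : ∀ n, (Module.finrank ℂ (H n) : ℂ) = n + 1 ∧
      (Module.finrank ℂ (H (n+1)) : ℂ) = n + 2 := by
    have h1 : ∀ n, (Module.finrank ℂ (H n) : ℂ) = LinearMap.trace ℂ (H n) (actH 1 n) := by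
      intro n
      rw [← LinearMap.trace_id]
      congr 1
      ext x
      rw [actH_coe, act_one]; rfl
    intro n
    induction n with
    | zero => simp [h1, trace_actH_zero, trace_actH_one]
    | succ k ih =>
      refine ⟨by rw [ih.2]; push_cast; ring, ?_⟩
      rw [h1, trace_actH_rec, ← h1, ← h1, ih.1, ih.2]
      simp
      ring
  exact_mod_cast (key n).1

/-- coprime forms generate everything in large degree -/
lemma coprime_gen {a b : S} {p q : ℕ} (ha : a ∈ H p) (hb : b ∈ H q) (ha0 : a ≠ 0) (hb0 : b ≠ 0)
    (hab : IsRelPrime a b) (n : ℕ) {z : S} (hz : z ∈ H (n + p + q)) :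
    ∃ u ∈ H (n + q), ∃ v ∈ H (n + p), z = a * u + b * v := by
  let i : H n →ₗ[ℂ] H (n+q) × H (n+p) :=
    LinearMap.prod (mulH b hb n (n+q) (by omega)) (-mulH a ha n (n+p) (by omega))
  let f : H (n+q) × H (n+p) →ₗ[ℂ] H (n+p+q) :=
    LinearMap.coprod (mulH a ha (n+q) (n+p+q) (by omega)) (mulH b hb (n+p) (n+p+q) (by omega))
  have hker : LinearMap.ker f ≤ LinearMap.range i := by
    rintro ⟨u, v⟩ h
    have h1 := congrArg Subtype.val (LinearMap.mem_ker.mp h)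
    simp only [f, LinearMap.coprod_apply, Submodule.coe_add, mulH_coe, Submodule.coe_zero] at h1
    have h2 : b ∣ a * (u : S) := ⟨-(v : S), by linear_combination h1⟩
    obtain ⟨w, hw⟩ := hab.symm.dvd_of_dvd_mul_left h2
    have hw' : w ∈ H n := by
      apply cofactor hb hb0
      rw [← hw, add_comm]
      exact u.2
    refine ⟨⟨w, hw'⟩, ?_⟩
    have h3 : (v : S) = - (a * w) := by
      apply mul_left_cancel₀ hb0
      rw [hw] at h1
      linear_combination h1
    ext1 <;> apply Subtype.ext
    · simp [i, mulH_coe, hw]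
    · simp [i, mulH_coe, h3]
  have hsurj : LinearMap.range f = ⊤ := by
    apply Submodule.eq_top_of_finrank_eq
    have e1 := LinearMap.finrank_range_add_finrank_ker f
    have e2 := Submodule.finrank_mono hker
    have e3 := LinearMap.finrank_range_le i
    have e4 := Submodule.finrank_le (LinearMap.range f)
    rw [Module.finrank_prod] at e1
    simp only [finrank_H] at *
    omega
  obtain ⟨⟨u, v⟩, huv⟩ := LinearMap.range_eq_top.mp hsurj ⟨z, hz⟩
  exact ⟨u, u.2, v, v.2, (congrArg Subtype.val huv).symm⟩

/-- the map encoding the grading -/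
noncomputable def Phi : S →ₐ[ℂ] Polynomial S :=
  aeval (fun i => Polynomial.C (X i) * Polynomial.X)

lemma Phi_hom {p : S} {n : ℕ} (hp : p ∈ H n) : Phi p = Polynomial.C p * Polynomial.X ^ n := by
  have : ∀ d : Fin 2 →₀ ℕ, ∀ c, Phi (monomial d c) =
      Polynomial.C (monomial d c) * Polynomial.X ^ d.degree := by
    intro d c
    rw [Phi, aeval_monomial, monomial_eq, Finsupp.degree]
    simp only [mul_pow, Finsupp.prod, Finset.prod_mul_distrib, Finset.prod_pow_eq_pow_sum,
      map_mul, map_prod, map_pow]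
    rw [mul_assoc]
    rfl
  conv_lhs => rw [p.as_sum, map_sum]
  conv_rhs => rw [p.as_sum, map_sum, Finset.sum_mul]
  refine Finset.sum_congr rfl fun d hd => ?_
  rw [this]
  congr 2
  have := IsHomogeneous.degree_eq_sum_deg_support hp hd
  rw [Finsupp.degree]
  exact this.symm

lemma Phi_coeff (p : S) (n : ℕ) : (Phi p).coeff n = homogeneousComponent n p := by
  conv_lhs => rw [← sum_homogeneousComponent p, map_sum]
  simp_rw [Phi_hom (homogeneousComponent_mem _ p), Polynomial.finsetSum_coeff,
    Polynomial.coeff_C_mul_X_pow]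
  rw [Finset.sum_ite_eq]
  split_ifs with h
  · rfl
  · rw [homogeneousComponent_eq_zero]
    simp at h
    omega

lemma hom_of_mul {a b : S} {n : ℕ} (h : a * b ∈ H n) (h0 : a * b ≠ 0) : ∃ k, a ∈ H k := by
  have ha : a ≠ 0 := left_ne_zero_of_mul h0
  have hb : b ≠ 0 := right_ne_zero_of_mul h0
  have inj : ∀ p : S, p ≠ 0 → Phi p ≠ 0 := by
    intro p hp hz
    apply hp
    rw [← sum_homogeneousComponent p]
    refine Finset.sum_eq_zero fun i _ => ?_
    rw [← Phi_coeff, hz, Polynomial.coeff_zero]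
  have e := Phi_hom h
  rw [map_mul] at e
  have e1 := congrArg Polynomial.natDegree e
  have e2 := congrArg Polynomial.natTrailingDegree e
  rw [Polynomial.natDegree_mul (inj _ ha) (inj _ hb), Polynomial.natDegree_C_mul_X_pow _ _ h0] at e1
  rw [Polynomial.natTrailingDegree_mul (inj _ ha) (inj _ hb),
    Polynomial.C_mul_X_pow_eq_monomial, Polynomial.natTrailingDegree_monomial h0] at e2
  have l1 := Polynomial.natTrailingDegree_le_natDegree (Phi a)
  have l2 := Polynomial.natTrailingDegree_le_natDegree (Phi b)
  refine ⟨(Phi a).natDegree, ?_⟩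
  have : a = homogeneousComponent (Phi a).natDegree a := by
    conv_lhs => rw [← sum_homogeneousComponent a]
    have hz : ∀ i, i ≠ (Phi a).natDegree → homogeneousComponent i a = 0 := by
      intro i hi
      rw [← Phi_coeff]
      rcases lt_or_gt_of_ne hi with hi | hi
      · exact Polynomial.coeff_eq_zero_of_lt_natTrailingDegree (by omega)
      · exact Polynomial.coeff_eq_zero_of_natDegree_lt hi
    rw [Finset.sum_eq_single (Phi a).natDegree (fun i _ hi => hz i hi)]
    intro hh
    rw [homogeneousComponent_eq_zero]
    simp at hh
    omega
  have h2 : homogeneousComponent (Phi a).natDegree a ∈ H (Phi a).natDegree :=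
    homogeneousComponent_mem _ _
  rwa [← this] at h2

lemma ideal_gcd (J : Ideal S) (hJ : ∀ p ∈ J, ∀ n, homogeneousComponent n p ∈ J) (h0 : J ≠ ⊥) :
    ∃ (m : ℕ) (f : S) (n0 : ℕ), f ∈ H m ∧ f ≠ 0 ∧ (∀ p ∈ J, f ∣ p) ∧
      ∀ n ≥ n0, ∀ q ∈ H n, f * q ∈ J := by
  classical
  let P : ℕ → Prop := fun m => ∃ f ∈ H m, f ≠ 0 ∧ ∃ n0, ∀ n ≥ n0, ∀ q ∈ H n, f * q ∈ J
  have hP : ∃ m, P m := by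
    obtain ⟨p, hp, hp0⟩ := Submodule.exists_mem_ne_zero_of_ne_bot h0
    have : ∃ n, homogeneousComponent n p ≠ 0 := by
      by_contra! hh
      apply hp0
      rw [← sum_homogeneousComponent p]
      exact Finset.sum_eq_zero fun i _ => hh i
    obtain ⟨n, hn⟩ := this
    exact ⟨n, _, homogeneousComponent_mem _ _, hn, 0, fun k _ q _ => J.mul_mem_right _ (hJ p hp n)⟩
  obtain ⟨f, hf, hf0, n0, hn0⟩ := Nat.find_spec hP
  refine ⟨Nat.find hP, f, n0, hf, hf0, ?_, hn0⟩
  -- homogeneous elements suffice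
  suffices ∀ k, ∀ p ∈ J, p ∈ H k → f ∣ p by
    intro p hp
    rw [← sum_homogeneousComponent p]
    exact Finset.dvd_sum fun i _ => this i _ (hJ p hp i) (homogeneousComponent_mem _ _)
  intro k j hj hjk
  by_contra hdvd
  have hj0 : j ≠ 0 := by rintro rfl; exact hdvd (dvd_zero _)
  obtain ⟨a, b, c, hrel, hfa, hjb⟩ := UniqueFactorizationMonoid.exists_reduced_factors f hf0 j
  obtain ⟨r, hr⟩ : ∃ r, c ∈ H r := hom_of_mul (b := a) (hfa ▸ hf) (hfa ▸ hf0)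
  obtain ⟨s, hs⟩ : ∃ s, a ∈ H s :=
    hom_of_mul (b := c) (by rw [mul_comm, hfa]; exact hf) (by rw [mul_comm, hfa]; exact hf0)
  obtain ⟨t, ht⟩ : ∃ t, b ∈ H t :=
    hom_of_mul (b := c) (by rw [mul_comm, hjb]; exact hjk) (by rw [mul_comm, hjb]; exact hj0)
  have hc0 : c ≠ 0 := by rintro rfl; simp at hfa; exact hf0 hfa.symm
  have ha0 : a ≠ 0 := by rintro rfl; simp at hfa; exact hf0 hfa.symm
  have hb0 : b ≠ 0 := by rintro rfl; simp at hjb; exact hj0 hjb.symm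
  have hrs : r + s = Nat.find hP := by
    have : c * a ∈ H (r + s) := IsHomogeneous.mul hr hs
    rw [hfa] at this
    exact IsHomogeneous.inj_right this hf hf0
  have hs0 : s ≠ 0 := by
    rintro rfl
    apply hdvd
    have ha1 : a = C (coeff 0 a) := by
      rw [← homogeneousComponent_zero]
      exact (homogeneousComponent_eq_self hs).symm
    have ha2 : coeff 0 a ≠ 0 := by
      intro h; rw [h, C_0] at ha1; exact ha0 ha1
    rw [← hfa, ← hjb]
    refine mul_dvd_mul_left c (IsUnit.dvd ?_)
    rw [ha1]
    exact (isUnit_iff_ne_zero.mpr ha2).map C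
  refine Nat.find_min hP (m := r) (by omega) ⟨c, hr, hc0, n0 + s + t, fun n hn q hq => ?_⟩
  obtain ⟨n', rfl⟩ : ∃ n', n = n' + s + t := ⟨n - s - t, by omega⟩
  obtain ⟨u, hu, v, hv, rfl⟩ := coprime_gen hs ht ha0 hb0 hrel n' hq
  have : c * (a * u + b * v) = f * u + j * v := by rw [← hfa, ← hjb]; ring
  rw [this]
  exact J.add_mem (hn0 _ (by omega) _ hu) (J.mul_mem_right _ hj)

end RankTwo


namespace RankTwo
open MvPolynomial

/-- trace on an invariant subspace -/
noncomputable def tr {E : Type*} [AddCommGroup E] [Module ℂ E] (P : Submodule ℂ E)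
    (f : E →ₗ[ℂ] E) : ℂ :=
  open Classical in if h : ∀ x ∈ P, f x ∈ P then LinearMap.trace ℂ P (f.restrict h) else 0

lemma tr_eq {E : Type*} [AddCommGroup E] [Module ℂ E] (P : Submodule ℂ E)
    (f : E →ₗ[ℂ] E) (h : ∀ x ∈ P, f x ∈ P) : tr P f = LinearMap.trace ℂ P (f.restrict h) := by
  rw [tr, dif_pos h]

section grp
variable {G : Type} [Group G] [Finite G] (r : G →* Matrix (Fin 2) (Fin 2) ℂ)

lemma act_act_inv (g : G) (p : S) : act (r g) (act (r g⁻¹) p) = p := by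
  rw [← AlgHom.comp_apply, ← act_mul, ← map_mul, mul_inv_cancel, map_one, act_one]; rfl

/-- the determinant character -/
noncomputable def detc : G →* ℂˣ := (Matrix.detMonoidHom.comp r).toHomUnits

lemma detc_coe (g : G) : (detc r g : ℂ) = (r g).det := rfl

variable (A : Subring (G → ℂ))

lemma s_mem (hV : (fun g => (r g).trace) ∈ A)
    (hA : ∀ χ : G →* ℂˣ, (fun g => (χ g : ℂ)) ∈ A) (n : ℕ) :
    (fun g => LinearMap.trace ℂ (H n) (actH (r g) n)) ∈ A := by
  have key : ∀ n, (fun g => LinearMap.trace ℂ (H n) (actH (r g) n)) ∈ A ∧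
      (fun g => LinearMap.trace ℂ (H (n+1)) (actH (r g) (n+1))) ∈ A := by
    intro n
    induction n with
    | zero =>
      refine ⟨?_, ?_⟩
      · simp only [trace_actH_zero]
        exact A.one_mem
      · have : (fun g => LinearMap.trace ℂ (H (0+1)) (actH (r g) (0+1))) =
            fun g => (r g).trace := funext fun g => trace_actH_one (r g)
        rw [this]
        exact hV
    | succ k ih =>
      refine ⟨ih.2, ?_⟩
      have : (fun g => LinearMap.trace ℂ (H (k+1+1)) (actH (r g) (k+1+1))) =
          (fun g => (r g).trace) * (fun g => LinearMap.trace ℂ (H (k+1)) (actH (r g) (k+1)))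
          - (fun g => (detc r g : ℂ)) * (fun g => LinearMap.trace ℂ (H k) (actH (r g) k)) := by
        funext g
        exact trace_actH_rec (r g) k
      rw [this]
      exact A.sub_mem (A.mul_mem hV ih.2) (A.mul_mem (hA _) ih.1)
  exact (key n).1

lemma dvd_of_pow {f h : S} {n : ℕ} (hf : f ≠ 0) (h0 : f ∣ h * X 0 ^ n) (h1 : f ∣ h * X 1 ^ n) :
    f ∣ h := by
  obtain ⟨f', h', c, hrel, rfl, rfl⟩ := UniqueFactorizationMonoid.exists_reduced_factors f hf h
  have hc : c ≠ 0 := left_ne_zero_of_mul hf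
  rw [mul_assoc] at h0 h1
  have e0 := hrel.dvd_of_dvd_mul_left ((mul_dvd_mul_iff_left hc).mp h0)
  have e1 := hrel.dvd_of_dvd_mul_left ((mul_dvd_mul_iff_left hc).mp h1)
  have : IsUnit f' := (X_isRelPrime.pow : IsRelPrime (X 0 ^ n : S) (X 1 ^ n)) e0 e1
  exact mul_dvd_mul_left c this.dvd

lemma semi_char (f : S) (hf0 : f ≠ 0) (h : ∀ g, ∃ c : ℂ, act (r g) f = c • f) :
    ∃ ψ : G →* ℂˣ, ∀ g, act (r g) f = (ψ g : ℂ) • f := by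
  choose c hc using h
  let c' : G →* ℂ :=
    { toFun := c
      map_one' := by
        have := hc 1
        rw [map_one, act_one, AlgHom.id_apply] at this
        have h2 : (c 1 - 1) • f = 0 := by rw [sub_smul, one_smul, ← this, sub_self]
        rcases smul_eq_zero.mp h2 with h | h
        · exact sub_eq_zero.mp h
        · exact absurd h hf0
      map_mul' := by
        intro g h
        have := hc (g * h)
        rw [map_mul, act_mul, AlgHom.comp_apply, hc h, map_smul, hc g, smul_smul] at this
        have h2 : (c (g * h) - c h * c g) • f = 0 := by rw [sub_smul, ← this, sub_self]
        rcases smul_eq_zero.mp h2 with h | h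
        · rw [sub_eq_zero.mp h, mul_comm]
        · exact absurd h hf0 }
  exact ⟨c'.toHomUnits, hc⟩

lemma ideal_trace (hV : (fun g => (r g).trace) ∈ A)
    (hA : ∀ χ : G →* ℂˣ, (fun g => (χ g : ℂ)) ∈ A) (J : Ideal S)
    (hJ : ∀ p ∈ J, ∀ n, homogeneousComponent n p ∈ J)
    (hst : ∀ g, ∀ p ∈ J, act (r g) p ∈ J) :
    ∃ n0, ∀ n ≥ n0, (fun g => tr (H n ⊓ J.restrictScalars ℂ) (act (r g)).toLinearMap) ∈ A := by
  have hst' : ∀ n g, ∀ p ∈ H n ⊓ J.restrictScalars ℂ,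
      (act (r g)).toLinearMap p ∈ H n ⊓ J.restrictScalars ℂ :=
    fun n g p hp => ⟨act_mem _ hp.1, hst g p hp.2⟩
  by_cases h0 : J = ⊥
  · refine ⟨0, fun n _ => ?_⟩
    have : ∀ g, tr (H n ⊓ J.restrictScalars ℂ) (act (r g)).toLinearMap = 0 := by
      intro g
      rw [tr_eq _ _ (hst' n g)]
      have : ((act (r g)).toLinearMap).restrict (hst' n g) = 0 := by
        ext x
        have hx : (x : S) = 0 := by
          have h3 : (x : S) ∈ J := x.2.2
          exact (Submodule.mem_bot S).mp (h0.le h3)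
        simp [LinearMap.restrict_apply, hx]
      rw [this, map_zero]
    simp_rw [this]
    exact A.zero_mem
  obtain ⟨m, f, n0, hf, hf0, hdvd, hin⟩ := ideal_gcd J hJ h0
  obtain ⟨ψ, hψ⟩ := semi_char r f hf0 (by
    intro g
    have h1 : ∀ i : Fin 2, f ∣ act (r g) f * X i ^ n0 := by
      intro i
      apply hdvd
      have h2 : act (r g) f * X i ^ n0 = act (r g) (f * act (r g⁻¹) (X i ^ n0)) := by
        rw [map_mul, act_act_inv]
      rw [h2]
      apply hst
      apply hin n0 le_rfl
      apply act_mem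
      simpa using isHomogeneous_X_pow (R := ℂ) i n0
    obtain ⟨u, hu⟩ := dvd_of_pow hf0 (h1 0) (h1 1)
    have hu0 : u ∈ H 0 := by
      apply cofactor hf hf0
      rw [← hu]
      exact act_mem _ hf
    have hu1 : u = C (coeff 0 u) := by
      rw [← homogeneousComponent_zero]
      exact (homogeneousComponent_eq_self hu0).symm
    exact ⟨coeff 0 u, by rw [hu, smul_eq_C_mul, ← hu1, mul_comm]⟩)
  refine ⟨m + n0, fun n hn => ?_⟩
  obtain ⟨k, rfl⟩ : ∃ k, n = m + k := ⟨n - m, by omega⟩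
  have : (fun g => tr (H (m + k) ⊓ J.restrictScalars ℂ) (act (r g)).toLinearMap) =
      (fun g => (ψ g : ℂ)) * (fun g => LinearMap.trace ℂ (H k) (actH (r g) k)) := by
    funext g
    let i : H k →ₗ[ℂ] (H (m + k) ⊓ J.restrictScalars ℂ : Submodule ℂ S) :=
      (LinearMap.mulLeft ℂ f).restrict (fun q hq => ⟨IsHomogeneous.mul hf hq, hin k (by omega) q hq⟩)
    have hi : ∀ q, (i q : S) = f * q := fun q => rfl
    haveI : FiniteDimensional ℂ (H (m + k) ⊓ J.restrictScalars ℂ : Submodule ℂ S) :=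
      Submodule.finiteDimensional_inf_left _ _
    rw [tr_eq _ _ (hst' _ g), trace_iso i ⟨?_, ?_⟩ ((ψ g : ℂ) • actH (r g) k)]
    · simp
    · intro q
      apply Subtype.ext
      rw [hi]
      change act (r g) (f * q) = _
      rw [map_mul, hψ, LinearMap.smul_apply, Submodule.coe_smul, actH_coe]
      simp
    · intro q q' hq
      have := congrArg Subtype.val hq
      rw [hi, hi] at this
      exact Subtype.ext (mul_left_cancel₀ hf0 this)
    · intro z
      obtain ⟨q, hq⟩ := hdvd z z.2.2
      have hq' : q ∈ H k := cofactor hf hf0 (hq ▸ z.2.1)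
      exact ⟨⟨q, hq'⟩, Subtype.ext (by rw [hi, hq])⟩
  rw [this]
  exact A.mul_mem (hA _) (s_mem r A hV hA k)

end grp
end RankTwo


namespace RankTwo
open MvPolynomial

section md
variable {G : Type} [Group G] [Finite G] (r : G →* Matrix (Fin 2) (Fin 2) ℂ)
variable {d : ℕ} (ρ : G →* Matrix (Fin d) (Fin d) ℂ)

/-- the diagonal action on the free module -/
noncomputable def T (g : G) : (Fin d → S) →ₗ[ℂ] (Fin d → S) :=
  LinearMap.pi fun i => ∑ j, ρ g i j • ((act (r g)).toLinearMap ∘ₗ LinearMap.proj j)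

lemma T_apply (g : G) (v : Fin d → S) (i : Fin d) :
    T r ρ g v i = ∑ j, ρ g i j • act (r g) (v j) := by
  simp [T]

lemma T_smul (g : G) (p : S) (v : Fin d → S) :
    T r ρ g (p • v) = act (r g) p • T r ρ g v := by
  funext i
  simp only [T_apply, Pi.smul_apply, smul_eq_mul, map_mul, Finset.mul_sum, mul_smul_comm]

lemma T_one (v : Fin d → S) : T r ρ 1 v = v := by
  funext i
  simp [T_apply, act_one, Matrix.one_apply]

lemma T_mul (g h : G) (v : Fin d → S) : T r ρ (g * h) v = T r ρ g (T r ρ h v) := by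
  funext i
  simp only [T_apply, map_mul, act_mul, AlgHom.comp_apply, Matrix.mul_apply, map_sum, map_smul,
    Finset.sum_smul, Finset.smul_sum, smul_smul]
  exact Finset.sum_comm

/-- the homogeneous part -/
noncomputable def Mg (d n : ℕ) : Submodule ℂ (Fin d → S) := Submodule.pi Set.univ fun _ => H n

lemma mem_Mg {n : ℕ} {v : Fin d → S} : v ∈ Mg d n ↔ ∀ i, v i ∈ H n := by
  simp [Mg, Submodule.mem_pi]

/-- projection to homogeneous components -/
noncomputable def pr (n : ℕ) : (Fin d → S) →ₗ[ℂ] (Fin d → S) :=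
  LinearMap.pi fun i => homogeneousComponent n ∘ₗ LinearMap.proj i

lemma pr_apply (n : ℕ) (v : Fin d → S) (i : Fin d) : pr n v i = homogeneousComponent n (v i) := rfl

lemma pr_mem (n : ℕ) (v : Fin d → S) : pr n v ∈ Mg d n :=
  mem_Mg.mpr fun i => homogeneousComponent_mem n (v i)

lemma pr_self {n : ℕ} {v : Fin d → S} (hv : v ∈ Mg d n) : pr n v = v :=
  funext fun i => homogeneousComponent_eq_self (mem_Mg.mp hv i)

lemma pr_smul {b : ℕ} {y : Fin d → S} (hy : y ∈ Mg d b) (n : ℕ) (p : S) :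
    pr (b + n) (p • y) = homogeneousComponent n p • y := by
  funext i
  rw [pr_apply, Pi.smul_apply, Pi.smul_apply, smul_eq_mul, smul_eq_mul, mul_comm,
    hom_comp_mul (mem_Mg.mp hy i), mul_comm]

lemma pr_smul_lt {b : ℕ} {y : Fin d → S} (hy : y ∈ Mg d b) (n : ℕ) (hn : n < b) (p : S) :
    pr n (p • y) = 0 := by
  funext i
  rw [pr_apply, Pi.smul_apply, smul_eq_mul, mul_comm, hom_comp_mul_lt (mem_Mg.mp hy i) n hn]
  rfl

lemma smul_mem_Mg {a b : ℕ} {p : S} {y : Fin d → S} (hp : p ∈ H a) (hy : y ∈ Mg d b) :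
    p • y ∈ Mg d (a + b) :=
  mem_Mg.mpr fun i => IsHomogeneous.mul hp (mem_Mg.mp hy i)

lemma T_mem {n : ℕ} {v : Fin d → S} (hv : v ∈ Mg d n) (g : G) : T r ρ g v ∈ Mg d n := by
  rw [mem_Mg] at *
  intro i
  rw [T_apply]
  exact Submodule.sum_mem _ fun j _ => Submodule.smul_mem _ _ (act_mem _ (hv j))

instance finMg (n : ℕ) : FiniteDimensional ℂ (Mg d n) := by
  let f : Mg d n →ₗ[ℂ] (Fin d → H n) :=
    { toFun := fun v i => ⟨v.1 i, mem_Mg.mp v.2 i⟩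
      map_add' := fun _ _ => rfl
      map_smul' := fun _ _ => rfl }
  refine FiniteDimensional.of_injective f ?_
  intro v w h
  apply Subtype.ext
  funext i
  exact congrArg Subtype.val (congrFun h i)

lemma trace_Mg (g : G) (n : ℕ) :
    tr (Mg d n) (T r ρ g) = LinearMap.trace ℂ (H n) (actH (r g) n) * (ρ g).trace := by
  rw [tr_eq _ _ (fun x hx => T_mem r ρ hx g)]
  let f : (Fin d → H n) →ₗ[ℂ] Mg d n :=
    { toFun := fun v => ⟨fun i => v i, mem_Mg.mpr fun i => (v i).2⟩
      map_add' := fun _ _ => rfl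
      map_smul' := fun _ _ => rfl }
  have hf : ∀ v i, (f v : Fin d → S) i = v i := fun _ _ => rfl
  let t : (Fin d → H n) →ₗ[ℂ] (Fin d → H n) :=
    ∑ i, ∑ j, LinearMap.single ℂ (fun _ => H n) i ∘ₗ
      ((ρ g i j • actH (r g) n) ∘ₗ LinearMap.proj j)
  have ht : ∀ v i, t v i = ∑ j, ρ g i j • actH (r g) n (v j) := by
    intro v i
    simp only [t, LinearMap.sum_apply, Finset.sum_apply, LinearMap.comp_apply,
      LinearMap.single_apply, Pi.single_apply, LinearMap.smul_apply, LinearMap.proj_apply]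
    rw [Finset.sum_comm]
    simp
  rw [trace_iso f ⟨?_, ?_⟩ t]
  · simp only [t, map_sum]
    have : ∀ i j, LinearMap.trace ℂ _ (LinearMap.single ℂ (fun _ : Fin d => H n) i ∘ₗ
      ((ρ g i j • actH (r g) n) ∘ₗ LinearMap.proj j)) =
        if i = j then ρ g i j * LinearMap.trace ℂ (H n) (actH (r g) n) else 0 := by
      intro i j
      rw [tcc, LinearMap.comp_assoc]
      split_ifs with h
      · subst h
        rw [LinearMap.proj_comp_single_same, LinearMap.comp_id, map_smul, smul_eq_mul]
      · rw [LinearMap.proj_comp_single_ne _ _ _ _ (Ne.symm h), LinearMap.comp_zero, map_zero]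
    simp_rw [this]
    rw [Matrix.trace, Finset.mul_sum]
    simp [mul_comm]
  · intro v
    apply Subtype.ext
    funext i
    rw [hf, ht]
    change T r ρ g (f v) i = _
    rw [T_apply]
    simp [hf, actH_coe]
  · intro v w h
    funext i
    apply Subtype.ext
    exact congrFun (congrArg Subtype.val h) i
  · intro v
    exact ⟨fun i => ⟨v.1 i, mem_Mg.mp v.2 i⟩, rfl⟩

variable (A : Subring (G → ℂ))

/-- good graded stable submodules -/
structure Good (F : Submodule S (Fin d → S)) : Prop where
  hom : ∀ v ∈ F, ∀ n, pr n v ∈ F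
  stab : ∀ g, ∀ v ∈ F, T r ρ g v ∈ F
  trc : ∃ n0, ∀ n ≥ n0, (fun g => tr (Mg d n ⊓ F.restrictScalars ℂ) (T r ρ g)) ∈ A

lemma good_bot : Good r ρ A ⊥ := by
  refine ⟨?_, ?_, 0, fun n _ => ?_⟩
  · intro v hv n
    rw [Submodule.mem_bot] at *
    rw [hv, map_zero]
  · intro g v hv
    rw [Submodule.mem_bot] at *
    rw [hv, map_zero]
  · have h0 : ∀ x : Fin d → S, x ∈ Mg d n ⊓ (⊥ : Submodule S (Fin d → S)).restrictScalars ℂ →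
      x = 0 := fun x hx => (Submodule.mem_bot S).mp hx.2
    have : ∀ g, tr (Mg d n ⊓ (⊥ : Submodule S (Fin d → S)).restrictScalars ℂ) (T r ρ g) = 0 := by
      intro g
      rw [tr_eq _ _ (fun x hx => by rw [h0 x hx, map_zero]; exact Submodule.zero_mem _)]
      have hz : ∀ h, (T r ρ g).restrict (p := Mg d n ⊓
          (⊥ : Submodule S (Fin d → S)).restrictScalars ℂ) (q := Mg d n ⊓
          (⊥ : Submodule S (Fin d → S)).restrictScalars ℂ) h = 0 := by
        intro h
        ext x : 1
        apply Subtype.ext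
        rw [LinearMap.coe_restrict_apply, h0 x x.2, map_zero]
        rfl
      rw [hz, map_zero]
    simp_rw [this]
    exact A.zero_mem

lemma C_smul' (c : ℂ) (v : Fin d → S) : (C c : S) • v = c • v := by
  funext i
  simp [smul_eq_C_mul]

lemma good_step (hV : (fun g => (r g).trace) ∈ A)
    (hA : ∀ χ : G →* ℂˣ, (fun g => (χ g : ℂ)) ∈ A) {F : Submodule S (Fin d → S)}
    (hF : Good r ρ A F) {b : ℕ} {y : Fin d → S} (hy : y ∈ Mg d b) (ψ : G →* ℂˣ)
    (hψ : ∀ g, T r ρ g y = (ψ g : ℂ) • y) : Good r ρ A (F ⊔ Submodule.span S {y}) := by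
  have hF' : ∀ v, v ∈ F ⊔ Submodule.span S {y} ↔ ∃ m ∈ F, ∃ p : S, m + p • y = v := by
    intro v
    simp [Submodule.mem_sup, Submodule.mem_span_singleton]
  have hT : ∀ g p, T r ρ g (p • y) = ((ψ g : ℂ) • act (r g) p) • y := by
    intro g p
    rw [T_smul, hψ, smul_comm, smul_assoc]
  have hstab : ∀ g, ∀ v ∈ F ⊔ Submodule.span S {y}, T r ρ g v ∈ F ⊔ Submodule.span S {y} := by
    intro g v hv
    obtain ⟨m, hm, p, rfl⟩ := (hF' v).mp hv
    rw [map_add, hT]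
    exact (hF' _).mpr ⟨_, hF.stab g m hm, _, rfl⟩
  have hhom : ∀ v ∈ F ⊔ Submodule.span S {y}, ∀ n, pr n v ∈ F ⊔ Submodule.span S {y} := by
    intro v hv n
    obtain ⟨m, hm, p, rfl⟩ := (hF' v).mp hv
    rw [map_add]
    rcases lt_or_ge n b with h | h
    · rw [pr_smul_lt hy n h, add_zero]
      exact Submodule.mem_sup_left (hF.hom m hm n)
    · obtain ⟨k, rfl⟩ := Nat.exists_eq_add_of_le h
      rw [pr_smul hy]
      exact (hF' _).mpr ⟨_, hF.hom m hm _, _, rfl⟩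
  refine ⟨hhom, hstab, ?_⟩
  let J : Ideal S := F.comap (LinearMap.toSpanSingleton S (Fin d → S) y)
  have hJ : ∀ p, p ∈ J ↔ p • y ∈ F := fun p => Iff.rfl
  have hJst : ∀ g, ∀ p ∈ J, act (r g) p ∈ J := by
    intro g p hp
    have h1 := hF.stab g _ ((hJ p).mp hp)
    rw [hT, smul_assoc, ← C_smul'] at h1
    have h2 := F.smul_mem (C ((ψ g : ℂ)⁻¹)) h1
    rw [smul_smul, ← C_mul, inv_mul_cancel₀ (ψ g).ne_zero, C_1, one_smul] at h2
    exact h2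
  obtain ⟨n1, hn1⟩ := ideal_trace r A hV hA J (by
    intro p hp n
    rw [hJ, ← pr_smul hy]
    exact hF.hom _ hp _) hJst
  obtain ⟨n2, hn2⟩ := hF.trc
  refine ⟨b + n1 + n2, fun n hn => ?_⟩
  obtain ⟨k, rfl⟩ := Nat.exists_eq_add_of_le (show b ≤ n by omega)
  have e : (fun g => tr (Mg d (b + k) ⊓ (F ⊔ Submodule.span S {y}).restrictScalars ℂ) (T r ρ g)) =
      (fun g => tr (Mg d (b + k) ⊓ F.restrictScalars ℂ) (T r ρ g)) +
      (fun g => (ψ g : ℂ)) * (fun g => LinearMap.trace ℂ (H k) (actH (r g) k)) -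
      (fun g => (ψ g : ℂ)) * (fun g => tr (H k ⊓ J.restrictScalars ℂ) (act (r g)).toLinearMap) := by
    funext g
    have s1 : ∀ x ∈ Mg d (b + k) ⊓ (F ⊔ Submodule.span S {y}).restrictScalars ℂ,
      T r ρ g x ∈ Mg d (b + k) ⊓ (F ⊔ Submodule.span S {y}).restrictScalars ℂ :=
      fun x hx => ⟨T_mem r ρ hx.1 g, hstab g x hx.2⟩
    have s2 : ∀ x ∈ Mg d (b + k) ⊓ F.restrictScalars ℂ,
      T r ρ g x ∈ Mg d (b + k) ⊓ F.restrictScalars ℂ :=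
      fun x hx => ⟨T_mem r ρ hx.1 g, hF.stab g x hx.2⟩
    have s3 : ∀ x ∈ H k ⊓ J.restrictScalars ℂ,
      (act (r g)).toLinearMap x ∈ H k ⊓ J.restrictScalars ℂ :=
      fun x hx => ⟨act_mem _ hx.1, hJst g x hx.2⟩
    simp only [Pi.add_apply, Pi.sub_apply, Pi.mul_apply]
    rw [tr_eq _ _ s1, tr_eq _ _ s2, tr_eq _ _ s3]
    have : FiniteDimensional ℂ (H k ⊓ J.restrictScalars ℂ : Submodule ℂ S) :=
      Submodule.finiteDimensional_inf_left _ _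
    have : FiniteDimensional ℂ (Mg d (b + k) ⊓ F.restrictScalars ℂ : Submodule ℂ (Fin d → S)) :=
      Submodule.finiteDimensional_inf_left _ _
    have : FiniteDimensional ℂ (Mg d (b + k) ⊓ (F ⊔ Submodule.span S {y}).restrictScalars ℂ :
      Submodule ℂ (Fin d → S)) := Submodule.finiteDimensional_inf_left _ _
    have hpy : ∀ p ∈ H k, p • y ∈ Mg d (b + k) := fun p hp => by
      rw [add_comm]; exact smul_mem_Mg hp hy
    let i : (H k ⊓ J.restrictScalars ℂ : Submodule ℂ S) →ₗ[ℂ]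
        (Mg d (b + k) ⊓ F.restrictScalars ℂ : Submodule ℂ (Fin d → S)) × H k :=
      { toFun := fun p => (⟨(-p.1) • y, hpy _ (Submodule.neg_mem _ p.2.1),
          ((hJ _).mp (J.neg_mem p.2.2))⟩, ⟨p.1, p.2.1⟩)
        map_add' := fun p q => by
          refine Prod.ext (Subtype.ext ?_) rfl
          change (-(p.1 + q.1)) • y = (-p.1) • y + (-q.1) • y
          rw [neg_add, add_smul]
        map_smul' := fun c p => by
          refine Prod.ext (Subtype.ext ?_) rfl
          change (-(c • p.1)) • y = c • ((-p.1) • y)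
          rw [← smul_neg, smul_assoc] }
    let q : (Mg d (b + k) ⊓ F.restrictScalars ℂ : Submodule ℂ (Fin d → S)) × H k →ₗ[ℂ]
        (Mg d (b + k) ⊓ (F ⊔ Submodule.span S {y}).restrictScalars ℂ :
          Submodule ℂ (Fin d → S)) :=
      { toFun := fun z => ⟨z.1.1 + z.2.1 • y,
          Submodule.add_mem _ z.1.2.1 (hpy _ z.2.2), (hF' _).mpr ⟨_, z.1.2.2, _, rfl⟩⟩
        map_add' := fun z w => by
          apply Subtype.ext
          change (z.1.1 + w.1.1) + (z.2.1 + w.2.1) • y = (z.1.1 + z.2.1 • y) + (w.1.1 + w.2.1 • y)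
          rw [add_smul]; abel
        map_smul' := fun c z => by
          apply Subtype.ext
          change c • z.1.1 + (c • z.2.1) • y = c • (z.1.1 + z.2.1 • y)
          rw [smul_add, smul_assoc] }
    have hq : ∀ z, (q z : Fin d → S) = z.1.1 + z.2.1 • y := fun z => rfl
    have ex := trace_exact i q ?_ ?_ ?_ ((ψ g : ℂ) • ((act (r g)).toLinearMap.restrict s3))
      (LinearMap.prodMap ((T r ρ g).restrict s2) ((ψ g : ℂ) • actH (r g) k))
      ((T r ρ g).restrict s1) ?_ ?_
    · rw [LinearMap.trace_prodMap'] at ex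
      simp only [map_smul, smul_eq_mul] at ex
      linear_combination -ex
    · intro p p' h
      exact Subtype.ext (congrArg (fun z => (z.2 : S)) h)
    · rintro ⟨v, hv1, hv2⟩
      obtain ⟨m, hm, p, hmp⟩ := (hF' v).mp hv2
      refine ⟨(⟨pr (b + k) m, pr_mem _ _, hF.hom m hm _⟩,
        ⟨homogeneousComponent k p, homogeneousComponent_mem k p⟩), ?_⟩
      apply Subtype.ext
      rw [hq]
      change pr (b + k) m + homogeneousComponent k p • y = v
      rw [← pr_smul hy, ← map_add, hmp, pr_self hv1]
    · rintro ⟨m, p⟩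
      constructor
      · intro h
        have h1 : m.1 + p.1 • y = 0 := congrArg Subtype.val h
        have h2 : m.1 = (-p.1) • y := by rw [neg_smul]; exact eq_neg_of_add_eq_zero_left h1
        have h3 : p.1 ∈ J := by
          have : -p.1 ∈ J := (hJ _).mpr (h2 ▸ m.2.2)
          simpa using J.neg_mem this
        exact ⟨⟨p.1, p.2, h3⟩, Prod.ext (Subtype.ext h2.symm) rfl⟩
      · rintro ⟨a, ha⟩
        rw [← ha]
        apply Subtype.ext
        change (-a.1) • y + a.1 • y = 0
        rw [neg_smul, neg_add_cancel]
    · intro p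
      refine Prod.ext (Subtype.ext ?_) (Subtype.ext ?_)
      · change T r ρ g ((-p.1) • y) = (-((ψ g : ℂ) • act (r g) p.1)) • y
        rw [hT, map_neg, smul_neg]
      · rfl
    · intro z
      apply Subtype.ext
      change T r ρ g z.1.1 + ((ψ g : ℂ) • act (r g) z.2.1) • y = T r ρ g (z.1.1 + z.2.1 • y)
      rw [map_add, hT]
  rw [e]
  exact A.sub_mem (A.add_mem (hn2 _ (by omega)) (A.mul_mem (hA _) (s_mem r A hV hA k)))
    (A.mul_mem (hA _) (hn1 _ (by omega)))

end md
end RankTwo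


namespace RankTwo
open MvPolynomial

section core
variable {G : Type} [Group G] [Finite G] (r : G →* Matrix (Fin 2) (Fin 2) ℂ)
variable {d : ℕ} (ρ : G →* Matrix (Fin d) (Fin d) ℂ)

lemma unip_pow {m : Matrix (Fin 2) (Fin 2) ℂ} (h : (m - 1) * (m - 1) = 0) (k : ℕ) :
    m ^ k = 1 + (k : ℂ) • (m - 1) := by
  induction k with
  | zero => simp
  | succ k ih =>
    have e : m = 1 + (m - 1) := by abel
    have e2 : (m - 1) * m = m - 1 := by
      conv_lhs => rw [e, mul_add, mul_one]
      simp [h]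
    rw [pow_succ, ih, add_mul, smul_mul_assoc, e2, one_mul]
    push_cast
    rw [add_smul, one_smul]
    abel

lemma det_one_sub (hr : Function.Injective r) {w : G} (hw : w ≠ 1) (hd : (r w).det = 1) :
    (1 - r w).det ≠ 0 := by
  intro h0
  apply hw
  apply hr
  rw [map_one]
  set m := r w with hm
  have hN : (m - 1) * (m - 1) = 0 := by
    rw [Matrix.det_fin_two] at h0 hd
    simp only [Matrix.sub_apply, Matrix.one_apply] at h0
    simp at h0
    have ht : m 0 0 + m 1 1 = 2 := by linear_combination -h0 + hd
    have ht' : m 1 1 = 2 - m 0 0 := by linear_combination ht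
    rw [ht'] at hd
    ext i j
    fin_cases i <;> fin_cases j <;> simp [Matrix.mul_apply, Fin.sum_univ_two, ht']
    · linear_combination -hd
    · ring
    · ring
    · linear_combination -hd
  have hk : m ^ Nat.card G = 1 := by rw [hm, ← map_pow, pow_card_eq_one', map_one]
  rw [unip_pow hN] at hk
  have h2 : ((Nat.card G : ℕ) : ℂ) • (m - 1) = 0 := by simpa using hk
  rcases smul_eq_zero.mp h2 with h | h
  · exact absurd (Nat.cast_eq_zero.mp h) Nat.card_pos.ne'
  · exact sub_eq_zero.mp h

lemma exists_q {m : Matrix (Fin 2) (Fin 2) ℂ} (hm : (1 - m).det ≠ 0) {l : S} (hl : l ∈ H 1) :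
    ∃ q ∈ H 1, q - act m q = l := by
  obtain ⟨c, rfl⟩ := mem_H_one hl
  let e := (1 - m)⁻¹.mulVec c
  have he : (1 - m).mulVec e = c := by
    rw [Matrix.mulVec_mulVec, Matrix.mul_nonsing_inv _ (isUnit_iff_ne_zero.mpr hm),
      Matrix.one_mulVec]
  refine ⟨e 0 • X 0 + e 1 • X 1, Submodule.add_mem _ (Submodule.smul_mem _ _ (X_mem 0))
    (Submodule.smul_mem _ _ (X_mem 1)), ?_⟩
  have h0 := congrFun he 0
  have h1 := congrFun he 1
  simp [Matrix.mulVec, dotProduct, Fin.sum_univ_two, Matrix.one_apply] at h0 h1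
  rw [← h0, ← h1]
  rw [map_add, map_smul, map_smul, act_X, act_X]
  simp only [smul_eq_C_mul, C_add, C_sub, C_mul, C_neg, C_1]
  ring

/-- twisted orbit functions -/
def orb : Submonoid (G → S) where
  carrier := {a | ∃ (p : S) (b j : ℕ), p ∈ H b ∧ ∀ g, a g = C ((r g).det ^ j) * act (r g) p}
  one_mem' := ⟨1, 0, 0, isHomogeneous_one _ _, fun g => by simp⟩
  mul_mem' := by
    rintro a a' ⟨p, b, j, hp, h⟩ ⟨p', b', j', hp', h'⟩
    refine ⟨p * p', b + b', j + j', IsHomogeneous.mul hp hp', fun g => ?_⟩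
    rw [Pi.mul_apply, h, h', map_mul, pow_add, C_mul]
    ring

lemma annih [Fintype G] (hr : Function.Injective r) (F : Submodule S (Fin d → S))
    (hsemi : ∀ (b : ℕ) (y : Fin d → S), y ∈ Mg d b → ∀ ψ : G →* ℂˣ,
      (∀ g, T r ρ g y = (ψ g : ℂ) • y) → y ∈ F)
    {x : Fin d → S} (hx : x ∈ Mg d 0) {l : S} (hl : l ∈ H 1) :
    l ^ (Fintype.card G - 1) • x ∈ F := by
  classical
  let E : (G → S) →ₗ[S] (Fin d → S) := Fintype.linearCombination S (fun g => T r ρ g x)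
  have hE : ∀ a, E a = ∑ g, a g • T r ρ g x := fun a => Fintype.linearCombination_apply ..
  have h1 : ∀ a ∈ orb r, E a ∈ F := by
    rintro a ⟨p, b, j, hp, ha⟩
    refine hsemi b _ ?_ ((detc r)⁻¹ ^ j) ?_
    · rw [hE]
      refine Submodule.sum_mem _ fun g _ => ?_
      refine smul_mem_Mg (a := b) ?_ (T_mem r ρ hx g)
      rw [ha, ← smul_eq_C_mul]
      exact Submodule.smul_mem _ _ (act_mem _ hp)
    · intro h
      rw [hE, map_sum, Finset.smul_sum]
      rw [← Equiv.sum_comp (Equiv.mulLeft h)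
        (fun g => ((((detc r)⁻¹ ^ j) h : ℂˣ) : ℂ) • a g • T r ρ g x)]
      refine Finset.sum_congr rfl fun g _ => ?_
      have key : act (r h) (a g) = C ((((detc r)⁻¹ ^ j) h : ℂˣ) : ℂ) * a (h * g) := by
        have h0 := (detc r h).ne_zero
        have hc : ∀ c : ℂ, act (r h) (C c) = C c := fun c => (act (r h)).commutes c
        rw [ha, ha, map_mul, map_mul, act_mul, AlgHom.comp_apply, Matrix.det_mul, hc,
          ← mul_assoc, ← C_mul]
        have e3 : (r g).det ^ j =
            ((((detc r)⁻¹ ^ j) h : ℂˣ) : ℂ) * ((r h).det * (r g).det) ^ j := by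
          simp only [MonoidHom.pow_apply, MonoidHom.inv_apply, Units.val_pow_eq_pow_val,
            Units.val_inv_eq_inv_val]
          rw [← detc_coe, ← detc_coe, mul_pow, ← mul_assoc, ← mul_pow, inv_mul_cancel₀ h0,
            one_pow, one_mul]
        rw [← e3]
      rw [T_smul, ← T_mul, key, mul_smul, C_smul', Equiv.coe_mulLeft]
  let Q := Algebra.adjoin S (orb r : Set (G → S))
  have hQ : ∀ a ∈ Q, E a ∈ F := by
    intro a ha
    have h2 : a ∈ Subalgebra.toSubmodule Q := ha
    rw [Algebra.adjoin_eq_span, Submonoid.closure_eq] at h2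
    exact (Submodule.span_le (p := F.comap E)).mpr h1 h2
  have h3 : ∀ w : G, w ≠ 1 → ∃ a ∈ Q, a w = 0 ∧ a 1 = l := by
    intro w hw
    by_cases hd : (r w).det = 1
    · obtain ⟨q, hq, hql⟩ := exists_q (det_one_sub r hr hw hd) hl
      refine ⟨(fun g => act (r g) q) - algebraMap S (G → S) (act (r w) q),
        Q.sub_mem (Algebra.subset_adjoin ⟨q, 1, 0, hq, fun g => by simp⟩)
          (Q.algebraMap_mem _), ?_, ?_⟩
      · simp
      · simp [act_one, hql]
    · refine ⟨(C (1 - (r w).det)⁻¹ * l) • ((fun g => C (r g).det) -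
        algebraMap S (G → S) (C (r w).det)),
        Q.smul_mem (Q.sub_mem (Algebra.subset_adjoin
          ⟨1, 0, 1, isHomogeneous_one _ _, fun g => by simp⟩)
          (Q.algebraMap_mem _)) _, ?_, ?_⟩
      · simp
      · have h4 : 1 - (r w).det ≠ 0 := sub_ne_zero.mpr (Ne.symm hd)
        simp only [Pi.smul_apply, Pi.sub_apply, map_one, Matrix.det_one, Pi.algebraMap_apply,
          Algebra.algebraMap_self, RingHom.id_apply, smul_eq_mul]
        rw [← C_1, ← C_sub, mul_right_comm, ← C_mul, inv_mul_cancel₀ h4, C_1, one_mul]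
  choose! a haQ haw ha1 using h3
  have h5 := hQ (∏ w ∈ Finset.univ.erase 1, a w)
    (Subalgebra.prod_mem _ fun w hw => haQ w (Finset.ne_of_mem_erase hw))
  rw [hE, Finset.sum_eq_single 1] at h5
  · rw [Finset.prod_apply, Finset.prod_congr rfl (fun w hw => ha1 w (Finset.ne_of_mem_erase hw)),
      Finset.prod_const, Finset.card_erase_of_mem (Finset.mem_univ _), Finset.card_univ, T_one] at h5
    exact h5
  · intro w _ hw
    rw [Finset.prod_apply, Finset.prod_eq_zero (f := fun c => a c w) (Finset.mem_erase.mpr ⟨hw, Finset.mem_univ w⟩)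
      (haw w hw), zero_smul]
  · simp

theorem core (hr : Function.Injective r) (A : Subring (G → ℂ))
    (hV : (fun g => (r g).trace) ∈ A)
    (hA : ∀ χ : G →* ℂˣ, (fun g => (χ g : ℂ)) ∈ A) : (fun g => (ρ g).trace) ∈ A := by
  classical
  have := Fintype.ofFinite G
  obtain ⟨F, hF, hmax⟩ := set_has_maximal_iff_noetherian.mpr
    (inferInstance : IsNoetherian S (Fin d → S)) {F | Good r ρ A F} ⟨⊥, good_bot r ρ A⟩
  have hsemi : ∀ (b : ℕ) (y : Fin d → S), y ∈ Mg d b → ∀ ψ : G →* ℂˣ,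
      (∀ g, T r ρ g y = (ψ g : ℂ) • y) → y ∈ F := by
    intro b y hy ψ hψ
    by_contra hn
    apply hmax _ (good_step r ρ A hV hA hF hy ψ hψ)
    refine lt_of_le_of_ne le_sup_left fun h => hn ?_
    rw [h]
    exact Submodule.mem_sup_right (Submodule.mem_span_singleton_self y)
  set k := Fintype.card G - 1 with hk
  have hMg : ∀ n, Mg d (n + k + k) ≤ F.restrictScalars ℂ := by
    intro n v hv
    change v ∈ F
    have : v = ∑ i, v i • (Pi.single i 1 : Fin d → S) := by
      funext j
      simp [Pi.single_apply]
    rw [this]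
    refine Submodule.sum_mem _ fun i _ => ?_
    have hx : (Pi.single i 1 : Fin d → S) ∈ Mg d 0 := by
      rw [mem_Mg]
      intro j
      rw [Pi.single_apply]
      split_ifs
      · exact isHomogeneous_one _ _
      · exact Submodule.zero_mem _
    have hp : ∀ i : Fin 2, (X i ^ k : S) ∈ H k := fun i => by
      simpa using isHomogeneous_X_pow (R := ℂ) i k
    obtain ⟨u, _, u', _, hu⟩ := coprime_gen (hp 0) (hp 1) (pow_ne_zero _ (X_ne_zero 0))
      (pow_ne_zero _ (X_ne_zero 1)) X_isRelPrime.pow n (mem_Mg.mp hv i)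
    rw [hu, add_smul, mul_comm, mul_smul, mul_comm, mul_smul]
    exact F.add_mem (F.smul_mem _ (annih r ρ hr F hsemi hx (X_mem 0)))
      (F.smul_mem _ (annih r ρ hr F hsemi hx (X_mem 1)))
  let P : ℕ → Prop := fun n =>
    (fun g => LinearMap.trace ℂ (H n) (actH (r g) n) * (ρ g).trace) ∈ A
  obtain ⟨n0, hn0⟩ := hF.trc
  have hP : ∀ n ≥ n0 + k + k, P n := by
    intro n hn
    have h1 := hn0 n (by omega)
    obtain ⟨j, rfl⟩ : ∃ j, n = j + k + k := ⟨n - k - k, by omega⟩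
    rw [inf_eq_left.mpr (hMg j)] at h1
    simp_rw [trace_Mg] at h1
    exact h1
  have hrec : ∀ n, P (n + 1) → P (n + 2) → P n := by
    intro n h1 h2
    have e : (fun g => LinearMap.trace ℂ (H n) (actH (r g) n) * (ρ g).trace) =
      (fun g => ((detc r)⁻¹ g : ℂ)) * ((fun g => (r g).trace) *
        (fun g => LinearMap.trace ℂ (H (n+1)) (actH (r g) (n+1)) * (ρ g).trace) -
        (fun g => LinearMap.trace ℂ (H (n+2)) (actH (r g) (n+2)) * (ρ g).trace)) := by
      funext g
      have h3 := (detc r g).ne_zero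
      simp only [Pi.mul_apply, Pi.sub_apply, MonoidHom.inv_apply, Units.val_inv_eq_inv_val]
      rw [trace_actH_rec, ← detc_coe]
      field_simp
      ring
    change _ ∈ A
    rw [e]
    exact A.mul_mem (hA _) (A.sub_mem (A.mul_mem hV h1) h2)
  have hall : ∀ N, (∀ n ≥ N, P n) → P 0 := by
    intro N
    induction N with
    | zero => exact fun h => h 0 le_rfl
    | succ N ih =>
      intro h
      apply ih
      intro n hn
      exact hrec n (h _ (by omega)) (h _ (by omega))
  have h0 := hall _ hP
  simp only [P, trace_actH_zero, one_mul] at h0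
  exact h0

end core
end RankTwo

open FiniteDimensional

theorem rank_two_reflection_group_repRing_generated (V : Type) [AddCommGroup V] [Module ℂ V]
    (hdim : Module.finrank ℂ V = 2)
    (W : Subgroup (LinearMap.GeneralLinearGroup ℂ V)) [Finite W]
    (hirr : ∀ p : Submodule ℂ V,
      (∀ (g : W) (x : V), x ∈ p → ((g : LinearMap.GeneralLinearGroup ℂ V) : V →ₗ[ℂ] V) x ∈ p) →
      p = ⊥ ∨ p = ⊤)
    (hrefl : W = Subgroup.closure {g : LinearMap.GeneralLinearGroup ℂ V | g ∈ W ∧ g ≠ 1 ∧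
      Module.finrank ℂ (LinearMap.ker ((g : V →ₗ[ℂ] V) - LinearMap.id)) = 1})
    (φ : FDRep ℂ W) (hφ : CategoryTheory.Simple φ) :
    φ.character ∈ Subring.closure
      ({fun g : W => LinearMap.trace ℂ V ((g : LinearMap.GeneralLinearGroup ℂ V) : V →ₗ[ℂ] V)} ∪
        {f : W → ℂ | ∃ χ : W →* ℂˣ, f = fun g => (χ g : ℂ)}) := by
  have : FiniteDimensional ℂ V := Module.finite_of_finrank_eq_succ hdim
  let b : Module.Basis (Fin 2) ℂ V := Module.finBasisOfFinrankEq ℂ V hdim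
  let r : W →* Matrix (Fin 2) (Fin 2) ℂ :=
    ((LinearMap.toMatrixAlgEquiv b : (V →ₗ[ℂ] V) ≃ₐ[ℂ] _) : (V →ₗ[ℂ] V) →* _).comp
      ((Units.coeHom (V →ₗ[ℂ] V)).comp W.subtype)
  have hr : ∀ g : W, r g = LinearMap.toMatrixAlgEquiv b
      ((g : LinearMap.GeneralLinearGroup ℂ V) : V →ₗ[ℂ] V) := fun g => rfl
  have hinj : Function.Injective r := by
    intro g h e
    rw [hr, hr] at e
    exact Subtype.ext (Units.ext ((LinearMap.toMatrixAlgEquiv b).injective e))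
  have htr : ∀ g : W, (r g).trace =
      LinearMap.trace ℂ V ((g : LinearMap.GeneralLinearGroup ℂ V) : V →ₗ[ℂ] V) := fun g =>
    (LinearMap.trace_eq_matrix_trace ℂ b _).symm
  let c := Module.finBasis ℂ φ
  let ρ : W →* Matrix (Fin (Module.finrank ℂ φ)) (Fin (Module.finrank ℂ φ)) ℂ :=
    ((LinearMap.toMatrixAlgEquiv c : (φ →ₗ[ℂ] φ) ≃ₐ[ℂ] _) : (φ →ₗ[ℂ] φ) →* _).comp φ.ρ
  have hρ : φ.character = fun g => (ρ g).trace := by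
    funext g
    exact LinearMap.trace_eq_matrix_trace ℂ c _
  rw [hρ]
  refine RankTwo.core r ρ hinj _ ?_ ?_
  · apply Subring.subset_closure
    left
    exact funext htr
  · intro χ
    exact Subring.subset_closure (Or.inr ⟨χ, rfl⟩)
end
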